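/- There is an absolute constant C > 0 with the following property. Let (X, dist) be a metric space, let ε ∈ (0, 1), let T ⊆ X be a finite set with |T| ≥ 2, and let W > 0. Suppose that for every nonempty finite subset T' ⊆ T and every real ℓ > 0 there exists an edge set E(T', ℓ) on T' such that w(E(T', ℓ)) ≤ W · |T'| · ℓ and such that d_{E(T', ℓ)}(x, y) ≤ (1 + ε) · dist(x, y) for all distinct x, y ∈ T' with ℓ/8 ≤ dist(x, y) ≤ ℓ (i.e., X admits a (1+ε)-spanner oracle with weak sparsity at most W on subsets of T). Then there exists an edge set S on T such that d_S(x, y) ≤ (1 + C·ε) · dist(x, y) for every x, y ∈ T, and w(S) ≤ C · max(W, ε⁻¹) · ε⁻² · log(2 + ε⁻¹) · mstw(T). -/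

import Mathlib

open scoped ENNReal BigOperators

universe u

/-- The distance function lifted to unordered pairs. -/
noncomputable def sym2Dist {X : Type u} [MetricSpace X] : Sym2 X → ℝ :=
  Sym2.lift ⟨fun x y => dist x y, fun _ _ => dist_comm _ _⟩

/-- The weight of an edge set: the sum of the distances of its pairs. -/
noncomputable def edgeWeight {X : Type u} [MetricSpace X] (E : Finset (Sym2 X)) : ℝ :=
  ∑ e ∈ E, sym2Dist e

/-- `E` is an edge set on `T`: a finite set of unordered pairs of distinct points of `T`. -/
def IsEdgeSetOn {X : Type u} (T : Finset X) (E : Finset (Sym2 X)) : Prop :=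
  ∀ e ∈ E, ¬ e.IsDiag ∧ ∀ x ∈ e, x ∈ T

/-- The length of the path starting at `p` and visiting the points of the list in order. -/
noncomputable def pathLength {X : Type u} [MetricSpace X] : X → List X → ℝ
  | _, [] => 0
  | p, x :: xs => dist p x + pathLength x xs

/-- `p :: l` is a path from `p` to `q` all of whose consecutive pairs are edges of `E`. -/
def IsPathIn {X : Type u} (E : Finset (Sym2 X)) (p q : X) (l : List X) : Prop :=
  List.Chain (fun a b => s(a, b) ∈ E) p l ∧ (p :: l).getLast (List.cons_ne_nil p l) = q

/-- The path-distance in the edge set `E`: the infimum in `[0, ∞]` of lengths of paths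
in `E` from `p` to `q`. -/
noncomputable def pathDist {X : Type u} [MetricSpace X] (E : Finset (Sym2 X)) (p q : X) :
    ℝ≥0∞ :=
  ⨅ (l : List X) (_ : IsPathIn E p q l), ENNReal.ofReal (pathLength p l)

/-- The minimum weight of an edge set on `T` connecting all points of `T` (MST weight). -/
noncomputable def mstw {X : Type u} [MetricSpace X] (T : Finset X) : ℝ :=
  sInf {w : ℝ | ∃ E : Finset (Sym2 X), IsEdgeSetOn T E ∧
    (∀ x ∈ T, ∀ y ∈ T, pathDist E x y < ⊤) ∧ w = edgeWeight E}


/-- Node-weighted walks with links of prescribed lengths. -/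
inductive Wk {N : Type} (J : N → N → ℝ → Prop) (ω : N → ℝ) : N → N → ℝ → Prop
  | nil (u : N) : Wk J ω u u (ω u)
  | cons {u v w : N} {l c : ℝ} : J u v l → Wk J ω v w c → Wk J ω u w (ω u + l + c)

/-- Plain links. -/
def HJ {N : Type} (Adj : N → N → Prop) : N → N → ℝ → Prop := fun u v l => Adj u v ∧ l = 0

/-- Plain links and extra links. -/
def EJ {N : Type} (Adj : N → N → Prop) (act : N → N → ℝ → Prop) : N → N → ℝ → Prop :=
  fun u v l => (Adj u v ∧ l = 0) ∨ act u v l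

theorem Wk.mono {N : Type} {J J' : N → N → ℝ → Prop} {ω : N → ℝ}
    (hJ : ∀ u v l, J u v l → J' u v l) {u v : N} {c : ℝ} (h : Wk J ω u v c) :
    Wk J' ω u v c := by
  induction h with
  | nil u => exact Wk.nil u
  | cons hl _ ih => exact Wk.cons (hJ _ _ _ hl) ih

theorem Wk.app {N : Type} {J : N → N → ℝ → Prop} {ω : N → ℝ}
    {u v w z : N} {c c' l : ℝ} (h : Wk J ω u v c) (hl : J v w l) (h' : Wk J ω w z c') :
    Wk J ω u z (c + l + c') := by
  induction h with
  | nil u => exact Wk.cons hl h'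
  | cons hl' _ ih =>
    have := Wk.cons hl' (ih hl)
    convert this using 1
    ring

theorem Wk.concat {N : Type} {J : N → N → ℝ → Prop} {ω : N → ℝ}
    {u v w : N} {c c' : ℝ} (h : Wk J ω u v c) (h' : Wk J ω v w c') :
    Wk J ω u w (c + c' - ω v) := by
  induction h with
  | nil u => simpa using h'
  | cons hl' _ ih =>
    have := Wk.cons hl' (ih h')
    convert this using 1
    ring

theorem Wk.symm {N : Type} {J : N → N → ℝ → Prop} {ω : N → ℝ}
    (hJ : ∀ u v l, J u v l → J v u l) {u v : N} {c : ℝ} (h : Wk J ω u v c) :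
    Wk J ω v u c := by
  induction h with
  | nil u => exact Wk.nil u
  | @cons u v w l c hl _ ih =>
    have := ih.app (hJ _ _ _ hl) (Wk.nil u)
    convert this using 1
    ring

theorem HJ.toEJ {N : Type} {Adj : N → N → Prop} {act : N → N → ℝ → Prop} {ω : N → ℝ}
    {u v : N} {c : ℝ} (h : Wk (HJ Adj) ω u v c) : Wk (EJ Adj act) ω u v c :=
  h.mono fun _ _ _ h => Or.inl h

theorem HJ.symm {N : Type} {Adj : N → N → Prop} (hA : ∀ u v, Adj u v → Adj v u) :
    ∀ u v l, HJ Adj u v l → HJ Adj v u l := fun _ _ _ h => ⟨hA _ _ h.1, h.2⟩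

theorem EJ.symm {N : Type} {Adj : N → N → Prop} {act : N → N → ℝ → Prop}
    (hA : ∀ u v, Adj u v → Adj v u) (hact : ∀ u v l, act u v l → act v u l) :
    ∀ u v l, EJ Adj act u v l → EJ Adj act v u l := fun _ _ _ h => by
  rcases h with h | h
  · exact Or.inl ⟨hA _ _ h.1, h.2⟩
  · exact Or.inr (hact _ _ _ h)

/-- Selecting a third of the vertices of a functional graph without internal arrows. -/
theorem functional_independent {κ : Type} [DecidableEq κ] (f : κ → κ) :
    ∀ (n : ℕ) (D : Finset κ), D.card = n → (∀ v ∈ D, f v ≠ v) →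
      ∃ A ⊆ D, (∀ v ∈ A, f v ∉ A) ∧ D.card ≤ 3 * A.card := by
  intro n
  induction n using Nat.strong_induction_on with
  | _ n ih =>
  intro D hD hf
  rcases D.eq_empty_or_nonempty with rfl | hne
  · exact ⟨∅, by simp, by simp, by simp⟩
  obtain ⟨v, hv, hv1⟩ : ∃ v ∈ D, (D.filter (fun u => f u = v)).card ≤ 1 := by
    by_contra hcon
    push Not at hcon
    have h1 : ∑ v ∈ D, (D.filter (fun u => f u = v)).card ≤ D.card := by
      rw [← Finset.card_biUnion]
      · apply Finset.card_le_card
        intro x hx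
        simp only [Finset.mem_biUnion, Finset.mem_filter] at hx
        obtain ⟨_, _, h, _⟩ := hx
        exact h
      · intro a _ b _ hab
        rw [Function.onFun, Finset.disjoint_left]
        intro x hx hx'
        simp only [Finset.mem_filter] at hx hx'
        exact hab (hx.2.symm.trans hx'.2)
    have h2 : ∑ v ∈ D, 2 ≤ ∑ v ∈ D, (D.filter (fun u => f u = v)).card :=
      Finset.sum_le_sum fun v hv => hcon v hv
    simp at h2
    have := hne.card_pos
    omega
  set D' := ((D.erase v).erase (f v)) \ (D.filter (fun u => f u = v)) with hD'
  have hsub : D' ⊆ D := by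
    intro x hx
    simp [hD'] at hx
    exact hx.1.2.2
  have hcard : D.card ≤ D'.card + 3 := by
    have h1 : ((D.erase v).erase (f v)).card - (D.filter (fun u => f u = v)).card ≤ D'.card :=
      Finset.le_card_sdiff (D.filter (fun u => f u = v)) ((D.erase v).erase (f v))
    have h2 := Finset.pred_card_le_card_erase (s := D.erase v) (a := f v)
    have h3 := Finset.pred_card_le_card_erase (s := D) (a := v)
    omega
  have hlt : D'.card < n := by
    rw [← hD]
    apply Finset.card_lt_card
    refine ⟨hsub, fun h => ?_⟩
    have := h hv
    simp [hD'] at this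
  obtain ⟨A, hA, hA1, hA2⟩ := ih _ hlt D' rfl (fun x hx => hf x (hsub hx))
  have hvA : v ∉ A := fun h => by
    have := hA h
    simp [hD'] at this
  refine ⟨insert v A, ?_, ?_, ?_⟩
  · intro x hx
    rcases Finset.mem_insert.1 hx with rfl | hx
    · exact hv
    · exact hsub (hA hx)
  · intro x hx
    rcases Finset.mem_insert.1 hx with rfl | hx
    · intro h
      rcases Finset.mem_insert.1 h with h | h
      · exact hf _ hv h
      · have := hA h
        simp [hD'] at this
    · intro h
      rcases Finset.mem_insert.1 h with h | h
      · have := hA hx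
        simp [hD'] at this
        exact this.2 this.1.2.2 h
      · exact hA1 x hx h
  · rw [Finset.card_insert_of_notMem hvA]
    omega

theorem exists_rec {N α : Type} (o : N) (par : N → N) (rk : N → ℕ)
    (hr : ∀ v, v ≠ o → rk (par v) < rk v) (a : α) (step : N → α → α) :
    ∃ F : N → α, F o = a ∧ ∀ v, v ≠ o → F v = step v (F (par v)) := by
  classical
  have hwf : WellFounded (fun a b : N => rk a < rk b) := (measure rk).wf
  let G : (v : N) → ((y : N) → rk y < rk v → α) → α := fun v ih =>
    if h : v = o then a else step v (ih (par v) (hr v h))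
  refine ⟨hwf.fix (C := fun _ => α) G, ?_, ?_⟩
  · rw [WellFounded.fix_eq]
    simp [G]
  · intro v hv
    rw [WellFounded.fix_eq]
    simp [G, hv]

theorem exists_tree {N : Type} (Adj : N → N → Prop) (hA : ∀ u v, Adj u v → Adj v u)
    (hc : ∀ u v, Relation.ReflTransGen Adj u v) (o : N) :
    ∃ (par : N → N) (rk : N → ℕ), ∀ v, v ≠ o → Adj v (par v) ∧ rk (par v) < rk v := by
  classical
  let G : SimpleGraph N := SimpleGraph.fromRel Adj
  have hconn : ∀ v, G.Reachable o v := by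
    intro v
    have := hc o v
    induction this with
    | refl => exact SimpleGraph.Reachable.refl _
    | @tail b c _ hbc ih =>
      by_cases h : b = c
      · rwa [← h]
      · exact ih.trans (SimpleGraph.Adj.reachable (by
          rw [SimpleGraph.fromRel_adj]; exact ⟨h, Or.inl hbc⟩))
  have key : ∀ v, ∃ p, v ≠ o → Adj v p ∧ G.dist p o < G.dist v o := by
    intro v
    by_cases h : v = o
    · exact ⟨v, fun h' => absurd h h'⟩
    obtain ⟨w, hw⟩ := (hconn v).symm.exists_walk_length_eq_dist
    cases w with
    | nil => exact absurd rfl h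
    | @cons _ p _ hadj q =>
      refine ⟨p, fun _ => ⟨?_, ?_⟩⟩
      · rw [SimpleGraph.fromRel_adj] at hadj
        rcases hadj.2 with h | h
        · exact h
        · exact hA _ _ h
      · have := SimpleGraph.dist_le q
        rw [SimpleGraph.Walk.length_cons] at hw
        omega
  choose par hpar using key
  exact ⟨par, fun v => G.dist v o, hpar⟩


/-- Long path decomposition of a rooted tree with node weights. -/
structure LPD {N : Type} (Adj : N → N → Prop) (ω : N → ℝ) (o : N) (par : N → N) (rk : N → ℕ)
    (d : N → N) (h : N → ℝ) : Prop where
  adj : ∀ v, v ≠ o → Adj v (par v)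
  rkl : ∀ v, v ≠ o → rk (par v) < rk v
  h0 : ∀ v, 0 ≤ h v
  h2 : ∀ v, v ≠ o → h v + ω v ≤ h (par v)
  h3 : ∀ v, v ≠ o → d (par v) = d v → h (par v) = h v + ω v
  h4 : ∀ u v, d u = d v → h u < h v → u ≠ o ∧ d (par u) = d u ∧ h (par u) ≤ h v
  h5 : ∀ u v, d u = d v → h u = h v → u = v
  h6 : ∀ v, h (d v) = 0
  h7 : ∀ v, d (d v) = d v

theorem exists_LPD {N : Type} [Fintype N] (Adj : N → N → Prop) (hA : ∀ u v, Adj u v → Adj v u)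
    (hc : ∀ u v, Relation.ReflTransGen Adj u v) (ω : N → ℝ) (hω : ∀ v, 0 < ω v) (o : N) :
    ∃ par rk d h, LPD Adj ω o par rk d h := by
  classical
  obtain ⟨par, rk, hpr⟩ := exists_tree Adj hA hc o
  obtain ⟨dep, -, hdep⟩ := exists_rec o par rk (fun v hv => (hpr v hv).2) (0 : ℝ)
    (fun v a => a + ω v)
  let R : N → N → Prop := fun a b => a ≠ o ∧ b = par a
  let key : N → ℝ ×ₗ Fin (Fintype.card N) := fun w => toLex (dep w, Fintype.equivFin N w)
  have hinj : Function.Injective key := by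
    intro a b hab
    have h1 : (dep a, Fintype.equivFin N a) = (dep b, Fintype.equivFin N b) := toLex.injective hab
    exact (Fintype.equivFin N).injective (Prod.ext_iff.1 h1).2
  have hkle : ∀ a b, key a ≤ key b → dep a ≤ dep b := by
    intro a b hab
    rw [Prod.Lex.toLex_le_toLex] at hab
    rcases hab with h | h
    · exact h.le
    · exact h.1.le
  have hmax : ∀ v, ∃ x, Relation.ReflTransGen R x v ∧
      ∀ w, Relation.ReflTransGen R w v → key w ≤ key x := by
    intro v
    obtain ⟨x, hx, hx'⟩ := Finset.exists_max_image
      (Finset.univ.filter (fun w => Relation.ReflTransGen R w v)) key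
      ⟨v, by simp [Relation.ReflTransGen.refl]⟩
    simp only [Finset.mem_filter, Finset.mem_univ, true_and] at hx hx'
    exact ⟨x, hx, hx'⟩
  choose d hd hd' using hmax
  have huniq : Relator.RightUnique R := by
    intro a b c hb hc
    rw [hb.2, hc.2]
  have hdd : ∀ u v, Relation.ReflTransGen R u v → dep v ≤ dep u := by
    intro u v huv
    induction huv with
    | refl => exact le_rfl
    | @tail b c _ hbc ih =>
      have := hdep b hbc.1
      rw [hbc.2]
      linarith [hω b]
  -- strict step
  have hstep : ∀ u v, Relation.ReflTransGen R u v → u ≠ v →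
      u ≠ o ∧ Relation.ReflTransGen R (par u) v := by
    intro u v huv hne
    rcases Relation.ReflTransGen.cases_head huv with h | ⟨c, hc1, hc2⟩
    · exact absurd h hne
    · exact ⟨hc1.1, hc1.2 ▸ hc2⟩
  have htot : ∀ u v, d u = d v → Relation.ReflTransGen R u v ∨ Relation.ReflTransGen R v u := by
    intro u v huv
    have h1 := hd u
    have h2 := hd v
    rw [← huv] at h2
    exact Relation.ReflTransGen.total_of_right_unique huniq h1 h2
  have hup : ∀ v, v ≠ o → Relation.ReflTransGen R v (par v) := fun v hv =>
    Relation.ReflTransGen.single ⟨hv, rfl⟩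
  have hlt : ∀ u v, Relation.ReflTransGen R u v → u ≠ v → dep v < dep u := by
    intro u v huv hne
    obtain ⟨h1, h2⟩ := hstep u v huv hne
    have := hdd _ _ h2
    have := hdep u h1
    linarith [hω u]
  have hddv : ∀ v, d (d v) = d v := by
    intro v
    apply hinj
    apply le_antisymm
    · exact hd' v _ ((hd (d v)).trans (hd v))
    · exact hd' (d v) _ Relation.ReflTransGen.refl
  refine ⟨par, rk, d, fun v => dep (d v) - dep v, fun v hv => (hpr v hv).1, fun v hv => (hpr v hv).2,
    ?_, ?_, ?_, ?_, ?_, ?_, hddv⟩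
  · intro v
    have := hdd _ _ (hd v)
    try dsimp only
    linarith
  · intro v hv
    have h1 := hkle _ _ (hd' (par v) (d v) ((hd v).trans (hup v hv)))
    have := hdep v hv
    try dsimp only
    linarith
  · intro v hv h
    have := hdep v hv
    try dsimp only
    rw [h]
    linarith
  · intro u v huv h
    try dsimp only at h
    rw [huv] at h
    have hne : u ≠ v := by rintro rfl; exact lt_irrefl _ h
    rcases htot u v huv with h1 | h1
    · obtain ⟨h2, h3⟩ := hstep u v h1 hne
      have h4 : d (par u) = d u := by
        apply hinj
        apply le_antisymm
        · rw [huv]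
          exact hd' v _ ((hd (par u)).trans h3)
        · exact hd' (par u) _ ((hd u).trans (hup u h2))
      refine ⟨h2, h4, ?_⟩
      try dsimp only
      rw [h4, huv]
      linarith [hdd _ _ h3]
    · have := hlt _ _ h1 hne.symm
      linarith
  · intro u v huv h
    try dsimp only at h
    rw [huv] at h
    by_contra hne
    rcases htot u v huv with h1 | h1
    · have := hlt _ _ h1 hne
      linarith
    · have := hlt _ _ h1 (Ne.symm hne)
      linarith
  · intro v
    try dsimp only
    rw [hddv]
    ring

section LPDlemmas
variable {N : Type} [Fintype N] {Adj : N → N → Prop} {ω : N → ℝ} {o : N} {par : N → N}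
  {rk : N → ℕ} {d : N → N} {h : N → ℝ}

theorem LPD.walk (P : LPD Adj ω o par rk d h) (u v : N) (hd : d u = d v) (hh : h u ≤ h v) :
    Wk (HJ Adj) ω u v (h v + ω v - h u) := by
  have key : ∀ n u, rk u = n → d u = d v → h u ≤ h v →
      Wk (HJ Adj) ω u v (h v + ω v - h u) := by
    intro n
    induction n using Nat.strong_induction_on with
    | _ n ih =>
    intro u hn hd hh
    rcases hh.eq_or_lt with he | hlt
    · obtain rfl := P.h5 u v hd he
      have := Wk.nil (J := HJ Adj) (ω := ω) u
      convert this using 1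
      ring
    · obtain ⟨h1, h2, h3⟩ := P.h4 u v hd hlt
      have h5 := P.h3 u h1 h2
      have := Wk.cons (⟨P.adj u h1, rfl⟩ : HJ Adj u (par u) 0)
        (ih (rk (par u)) (hn ▸ P.rkl u h1) (par u) rfl (h2.trans hd) h3)
      convert this using 1
      rw [h5]
      ring
  exact key _ u rfl hd hh

theorem LPD.sum [DecidableEq N] (P : LPD Adj ω o par rk d h) (hω : ∀ v, 0 < ω v) (u v : N)
    (hd : d u = d v)
    (hh : h u ≤ h v) :
    ∑ w ∈ Finset.univ.filter (fun w => d w = d v ∧ h u ≤ h w ∧ h w ≤ h v), ω w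
      = h v + ω v - h u := by
  classical
  have key : ∀ n u, rk u = n → d u = d v → h u ≤ h v →
      ∑ w ∈ Finset.univ.filter (fun w => d w = d v ∧ h u ≤ h w ∧ h w ≤ h v), ω w
      = h v + ω v - h u := by
    intro n
    induction n using Nat.strong_induction_on with
    | _ n ih =>
    intro u hn hd hh
    rcases hh.eq_or_lt with he | hlt
    · obtain rfl := P.h5 u v hd he
      have : Finset.univ.filter (fun w => d w = d u ∧ h u ≤ h w ∧ h w ≤ h u) = {u} := by
        ext w
        simp only [Finset.mem_filter, Finset.mem_univ, true_and, Finset.mem_singleton]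
        constructor
        · rintro ⟨h1, h2, h3⟩
          exact P.h5 w u h1 (le_antisymm h3 h2)
        · rintro rfl
          simp
      rw [this]
      simp
    · obtain ⟨h1, h2, h3⟩ := P.h4 u v hd hlt
      have h5 := P.h3 u h1 h2
      have := ih (rk (par u)) (hn ▸ P.rkl u h1) (par u) rfl (h2.trans hd) h3
      have hs : Finset.univ.filter (fun w => d w = d v ∧ h u ≤ h w ∧ h w ≤ h v)
          = insert u (Finset.univ.filter
            (fun w => d w = d v ∧ h (par u) ≤ h w ∧ h w ≤ h v)) := by
        ext w
        simp only [Finset.mem_filter, Finset.mem_univ, true_and, Finset.mem_insert]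
        constructor
        · rintro ⟨h6, h7, h8⟩
          rcases h7.eq_or_lt with he | hl
          · exact Or.inl (P.h5 w u (h6.trans hd.symm) he.symm)
          · refine Or.inr ⟨h6, ?_, h8⟩
            exact (P.h4 u w (hd.trans h6.symm) hl).2.2
        · rintro (rfl | ⟨h6, h7, h8⟩)
          · exact ⟨hd, le_rfl, hh⟩
          · exact ⟨h6, by linarith [hω u], h8⟩
      rw [hs, Finset.sum_insert, this, h5]
      · ring
      · simp only [Finset.mem_filter, Finset.mem_univ, true_and, not_and]
        intro _ h7
        linarith [hω u]
  exact key _ u rfl hd hh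

/-- Weight of a set of nodes in one class. -/
theorem LPD.sum_le (P : LPD Adj ω o par rk d h) (hω : ∀ v, 0 < ω v) {e : ℝ} (he : ∀ v, ω v ≤ e)
    (A : Finset N) (x : N) (α α' : ℝ) (hA : ∀ w ∈ A, d w = x ∧ α ≤ h w ∧ h w ≤ α')
    (hαα : α ≤ α') (he0 : 0 ≤ e) :
    ∑ w ∈ A, ω w ≤ α' - α + e := by
  classical
  rcases A.eq_empty_or_nonempty with rfl | hne
  · simp only [Finset.sum_empty]
    linarith
  obtain ⟨u, hu, hu'⟩ := Finset.exists_min_image A h hne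
  obtain ⟨v, hv, hv'⟩ := Finset.exists_max_image A h hne
  have h1 := P.sum hω u v ((hA u hu).1.trans (hA v hv).1.symm) (hu' v hv)
  have h2 : ∑ w ∈ A, ω w ≤
      ∑ w ∈ Finset.univ.filter (fun w => d w = d v ∧ h u ≤ h w ∧ h w ≤ h v), ω w := by
    apply Finset.sum_le_sum_of_subset_of_nonneg
    · intro w hw
      simp only [Finset.mem_filter, Finset.mem_univ, true_and]
      exact ⟨(hA w hw).1.trans (hA v hv).1.symm, hu' w hw, hv' w hw⟩
    · intro i _ _
      exact (hω i).le
  linarith [he v, (hA u hu).2.1, (hA v hv).2.2]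

/-- Tile property. -/
theorem LPD.tile (P : LPD Adj ω o par rk d h) (hω : ∀ v, 0 < ω v) (u w : N) (hd : d u = d w) (z : ℝ)
    (h1 : h u < z) (h2 : z ≤ h w + ω w) :
    ∃ x, d x = d u ∧ h u ≤ h x ∧ h x < z ∧ z ≤ h x + ω x := by
  have key : ∀ n u, rk u = n → d u = d w → h u < z →
      ∃ x, d x = d u ∧ h u ≤ h x ∧ h x < z ∧ z ≤ h x + ω x := by
    intro n
    induction n using Nat.strong_induction_on with
    | _ n ih =>
    intro u hn hd h1
    by_cases hz : z ≤ h u + ω u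
    · exact ⟨u, rfl, le_rfl, h1, hz⟩
    push Not at hz
    have hlt : h u < h w := by
      rcases lt_trichotomy (h u) (h w) with h | h | h
      · exact h
      · have := P.h5 u w hd h
        subst this
        linarith
      · exfalso
        have := (P.h4 w u hd.symm h)
        have h3 := P.h3 w this.1 this.2.1
        linarith [this.2.2, hω u]
    obtain ⟨h4, h5, h6⟩ := P.h4 u w hd hlt
    have h7 := P.h3 u h4 h5
    obtain ⟨x, hx1, hx2, hx3, hx4⟩ :=
      ih (rk (par u)) (hn ▸ P.rkl u h4) (par u) rfl (h5.trans hd) (by linarith)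
    exact ⟨x, hx1.trans h5, by linarith [hω u], hx3, hx4⟩
  exact key _ u rfl hd h1

/-- Bottom edge property. -/
theorem LPD.bot (P : LPD Adj ω o par rk d h) (hω : ∀ v, 0 < ω v) (v : N) (z : ℝ)
    (h1 : 0 < z) (h2 : z ≤ h v) :
    ∃ x, d x = d v ∧ z ≤ h x ∧ h x ≤ h v ∧ ∃ y, d y = d v ∧ h y < z ∧ h x = h y + ω y := by
  obtain ⟨y, hy1, hy2, hy3, hy4⟩ := P.tile hω (d v) v (P.h7 v) z (by rw [P.h6]; exact h1)
    (by linarith [hω v])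
  rw [P.h7] at hy1
  obtain ⟨h3, h4, h5⟩ := P.h4 y v hy1 (by linarith)
  have h6 := P.h3 y h3 h4
  exact ⟨par y, h4.trans hy1, by linarith, h5, y, hy1, hy3, h6⟩

/-- Weight of the lower part of a class. -/
theorem LPD.low_sum [DecidableEq N] (P : LPD Adj ω o par rk d h) (hω : ∀ v, 0 < ω v) (v : N) (z : ℝ)
    (h1 : 0 < z) (h2 : z ≤ h v) :
    z ≤ ∑ w ∈ Finset.univ.filter (fun w => d w = d v ∧ h w < z), ω w := by
  obtain ⟨y, hy1, hy2, hy3, hy4⟩ := P.tile hω (d v) v (P.h7 v) z (by rw [P.h6]; exact h1)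
    (by linarith [hω v])
  have hs := P.sum hω (d v) y (by rw [P.h7, hy1, P.h7]) hy2
  rw [P.h6] at hs
  refine le_trans (by linarith) (hs.symm.le.trans ?_)
  apply Finset.sum_le_sum_of_subset_of_nonneg
  · intro w hw
    simp only [Finset.mem_filter, Finset.mem_univ, true_and] at hw ⊢
    rw [hw.1, hy1, P.h7]
    exact ⟨rfl, by linarith [hw.2.2]⟩
  · intro i _ _
    exact (hω i).le

end LPDlemmas


/-- Block index of a position on a path of length `m`, shift `j`, granularity `β`. -/
noncomputable def blk (β m : ℝ) (j : ℕ) (y : ℝ) : ℕ :=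
  min ⌊y / β - j / 3⌋₊ (⌊m / β - j / 3⌋₊ - 1)

theorem blk_mono {β : ℝ} (hβ : 0 < β) (m : ℝ) (j : ℕ) : Monotone (blk β m j) := by
  intro a b hab
  unfold blk
  have : a / β ≤ b / β := by gcongr
  exact min_le_min_right _ (Nat.floor_le_floor (by linarith))

theorem floor_pos_le {x : ℝ} {t : ℕ} (h : ⌊x⌋₊ = t) (ht : 1 ≤ t) : (t : ℝ) ≤ x := by
  rw [← h]
  apply Nat.floor_le
  by_contra hx
  rw [Nat.floor_of_nonpos (by linarith)] at h
  omega

theorem blk_diam {β m : ℝ} (hβ : 0 < β) {j : ℕ} (hj : j < 3) {y y' : ℝ}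
    (hy0 : 0 ≤ y) (hy'm : y' < m) (hb : blk β m j y = blk β m j y') : y' - y ≤ 3 * β := by
  unfold blk at hb
  have hj2 : (j : ℝ) ≤ 2 := by exact_mod_cast Nat.lt_succ_iff.1 hj
  have hj0 : (0 : ℝ) ≤ j := Nat.cast_nonneg j
  set K := ⌊m / β - j / 3⌋₊ with hK
  have hK1 : m / β - j / 3 < K + 1 := Nat.lt_floor_add_one _
  have hy1 : y' / β - j / 3 < ⌊y' / β - j / 3⌋₊ + 1 := Nat.lt_floor_add_one _
  have hy'2 : y' / β < m / β := by gcongr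
  have hy2 : 0 ≤ y / β := by positivity
  have goal : y' / β - y / β ≤ 3 := by
    set f := ⌊y / β - j / 3⌋₊ with hf
    set f' := ⌊y' / β - j / 3⌋₊ with hf'
    by_cases hf0 : f' ≤ 0
    · have : (f' : ℝ) = 0 := by exact_mod_cast Nat.le_zero.1 hf0
      linarith
    by_cases hK2 : K ≤ 1
    · have : (K : ℝ) ≤ 1 := by exact_mod_cast hK2
      linarith
    have hfp : 1 ≤ f := by omega
    have h1 := floor_pos_le hf.symm hfp
    by_cases hlt : f' < K - 1
    · have h3 : f = f' := by omega
      rw [← h3] at hy1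
      linarith
    · have h3 : K ≤ f + 1 := by omega
      have : (K : ℝ) ≤ f + 1 := by exact_mod_cast h3
      linarith
  have h1 : y = y / β * β := by field_simp
  have h2 : y' = y' / β * β := by field_simp
  rw [h1, h2]
  nlinarith

theorem blk_ext {β m : ℝ} (hβ : 0 < β) {j : ℕ} {y : ℝ}
    (hy0 : 0 ≤ y) (hym : y < m) :
    ∃ a b, 0 ≤ a ∧ a ≤ y ∧ y < b ∧ b ≤ m ∧ min m β ≤ b - a ∧
      ∀ y', a ≤ y' → y' < b → blk β m j y' = blk β m j y := by
  unfold blk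
  have hj0 : (0 : ℝ) ≤ j := Nat.cast_nonneg j
  set K := ⌊m / β - j / 3⌋₊ with hK
  set f := ⌊y / β - j / 3⌋₊ with hf
  have hyf : y / β - j / 3 < f + 1 := Nat.lt_floor_add_one _
  have fup : ∀ (y' : ℝ) (t : ℕ), y' < (t + 1 + j / 3) * β → ⌊y' / β - j / 3⌋₊ ≤ t := by
    intro y' t h
    apply Nat.lt_succ_iff.1
    rw [Nat.floor_lt' (by omega)]
    push_cast
    have : y' / β < t + 1 + j / 3 := by rwa [div_lt_iff₀ hβ]
    linarith
  have flo : ∀ (y' : ℝ) (t : ℕ), (t + j / 3) * β ≤ y' → t ≤ ⌊y' / β - j / 3⌋₊ := by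
    intro y' t h
    apply Nat.le_floor
    have : t + j / 3 ≤ y' / β := by rwa [le_div_iff₀ hβ]
    linarith
  have hyf2 : y < (f + 1 + j / 3) * β := by
    rw [← div_lt_iff₀ hβ]
    linarith
  by_cases hK2 : K ≤ 1
  · refine ⟨0, m, le_rfl, hy0, hym, le_rfl, by simp, ?_⟩
    intro y' _ _
    omega
  have hKm : (K + j / 3) * β ≤ m := by
    have := floor_pos_le hK.symm (by omega)
    rw [← le_div_iff₀ hβ]
    linarith
  by_cases hf0 : f = 0
  · refine ⟨0, (0 + 1 + j / 3) * β, le_rfl, hy0, ?_, ?_, ?_, ?_⟩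
    · rw [hf0] at hyf2
      simpa using hyf2
    · refine le_trans ?_ hKm
      have : (2 : ℝ) ≤ K := by exact_mod_cast (by omega : 2 ≤ K)
      gcongr
      linarith
    · apply (min_le_right _ _).trans
      have : 0 ≤ (j : ℝ) / 3 * β := by positivity
      nlinarith
    · intro y' _ h
      have := fup y' 0 (by simpa using h)
      omega
  have hfy : (f + j / 3) * β ≤ y := by
    have := floor_pos_le hf.symm (by omega)
    rw [← le_div_iff₀ hβ]
    linarith
  by_cases hfK : f < K - 1
  · refine ⟨(f + j / 3) * β, (f + 1 + j / 3) * β, by positivity, hfy, hyf2, ?_, ?_, ?_⟩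
    · refine le_trans ?_ hKm
      have : (f : ℝ) + 1 ≤ K := by exact_mod_cast (by omega : f + 1 ≤ K)
      gcongr
    · apply (min_le_right _ _).trans
      nlinarith
    · intro y' h1 h2
      have := fup y' f h2
      have := flo y' f h1
      omega
  · have hc : ((K - 1 : ℕ) : ℝ) = K - 1 := by
      rw [Nat.cast_sub (by omega)]
      simp
    refine ⟨((K - 1 : ℕ) + j / 3) * β, m, by positivity, ?_, hym, le_rfl, ?_, ?_⟩
    · refine le_trans ?_ hfy
      have : ((K - 1 : ℕ) : ℝ) ≤ f := by exact_mod_cast (by omega : K - 1 ≤ f)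
      gcongr
    · apply (min_le_right _ _).trans
      rw [hc]
      nlinarith
    · intro y' h1 h2
      have := flo y' (K - 1) h1
      omega

theorem blk_win {β : ℝ} (hβ : 0 < β) (m : ℝ) {y : ℝ} (hy0 : 0 ≤ y) :
    ∃ j < 3, ∀ y', |y' - y| < β / 3 → blk β m j y' = blk β m j y := by
  set n := ⌊y / (β / 3)⌋₊ with hn
  have h1 : (n : ℝ) * (β / 3) ≤ y := by
    rw [← le_div_iff₀ (by positivity)]
    exact Nat.floor_le (by positivity)
  have h2 : y < (n + 1) * (β / 3) := by
    rw [← div_lt_iff₀ (by positivity)]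
    exact Nat.lt_floor_add_one _
  refine ⟨(n + 2) % 3, Nat.mod_lt _ (by norm_num), ?_⟩
  have key : ∀ y', |y' - y| < β / 3 →
      ⌊y' / β - ((n + 2) % 3 : ℕ) / 3⌋₊ = (n + 2) / 3 - 1 := by
    intro y' hy'
    rw [abs_lt] at hy'
    set q := (n + 2) / 3 with hq
    set j := (n + 2) % 3 with hj
    have hqj : (n : ℝ) + 2 = 3 * q + j := by
      have : n + 2 = 3 * q + j := by omega
      exact_mod_cast this
    have h3 : y' / β < q + j / 3 := by
      rw [div_lt_iff₀ hβ]
      have : (q + j / 3) * β = (n + 2) * (β / 3) := by rw [hqj]; ring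
      rw [this]
      nlinarith
    have h4 : (q : ℝ) - 1 + j / 3 < y' / β := by
      rw [lt_div_iff₀ hβ]
      have : (q - 1 + j / 3) * β = (n - 1) * (β / 3) := by
        have : (n : ℝ) = 3 * q + j - 2 := by linarith
        rw [this]; ring
      rw [this]
      nlinarith
    rcases Nat.eq_zero_or_pos q with h0 | hpos
    · rw [h0] at h3 ⊢
      simp only [Nat.zero_sub]
      apply Nat.floor_of_nonpos
      push_cast at h3
      linarith
    · have hc : ((q - 1 : ℕ) : ℝ) = q - 1 := by
        rw [Nat.cast_sub (by omega)]
        simp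
      rw [Nat.floor_eq_iff (by
        have : (1 : ℝ) ≤ q := by exact_mod_cast hpos
        linarith), hc]
      constructor <;> linarith
  intro y' hy'
  unfold blk
  rw [key y' hy', key y (by simpa using by positivity)]


theorem merge_lemma {N κ : Type} [Fintype N] [DecidableEq κ] (Adj : N → N → Prop)
    (hA : ∀ u v, Adj u v → Adj v u) (J : N → N → ℝ → Prop) (hJ : ∀ u v l, J u v l → J v u l)
    (hAJ : ∀ u v, Adj u v → J u v 0) (ω : N → ℝ) (L hb : ℝ) (hL : 0 ≤ L)
    (Kept : N → Prop) (key : N → κ) (Gs : Finset κ)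
    (hGs : ∀ G, G ∈ Gs ↔ ∃ v, Kept v ∧ key v = G)
    (σ : κ → ℝ) (hσ : ∀ G ∈ Gs, L ≤ σ G ∧ σ G ≤ hb)
    (hdiam : ∀ u v, Kept u → Kept v → key u = key v → ∃ c ≤ σ (key u), Wk J ω u v c)
    (star : N → N) (hstar : ∀ v, Kept (star v)) (hstar1 : ∀ v, Kept v → star v = v)
    (hstar2 : ∀ v, ∃ c ≤ 4 * L + ω (star v), Wk J ω v (star v) c)
    (hconn : ∀ u v, Kept u → Kept v →
      Relation.ReflTransGen (fun a b => Adj a b ∧ Kept a ∧ Kept b) u v)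
    (I : Finset κ) (hI : I ⊆ Gs) (gate : κ → N)
    (hg : ∀ G ∈ I, Kept (gate G) ∧ key (gate G) ≠ G ∧
      ∀ u, Kept u → key u = G → ∃ c ≤ σ G - L + ω (gate G), Wk J ω u (gate G) c) :
    ∃ (N' : Type) (_ : Fintype N') (Adj' : N' → N' → Prop) (ω' : N' → ℝ) (π' : N → N'),
      (∀ u v, Adj' u v → Adj' v u) ∧ (∀ u v, Relation.ReflTransGen Adj' u v) ∧
      (∀ u, L ≤ ω' u ∧ ω' u ≤ 3 * hb) ∧
      (∀ u v c', Wk (HJ Adj') ω' (π' u) (π' v) c' → ∃ c ≤ c' + 8 * L, Wk J ω u v c) ∧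
      ∑ u, ω' u ≤ ∑ G ∈ Gs, σ G - L / 3 * I.card := by
  classical
  obtain ⟨A, hAI, hA1, hA2⟩ := functional_independent (fun G => key (gate G)) _ I rfl
    (fun G hG => (hg G hG).2.1)
  set f : κ → κ := fun G => key (gate G) with hf
  set φ : κ → κ := fun G => if G ∈ A then f G else G with hφ
  have hfG : ∀ G ∈ A, f G ∈ Gs := fun G hG => (hGs _).2 ⟨gate G, (hg G (hAI hG)).1, rfl⟩
  have hφG : ∀ G ∈ Gs, φ G ∈ Gs \ A := by
    intro G hG
    simp only [hφ]
    split_ifs with h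
    · exact Finset.mem_sdiff.2 ⟨hfG G h, hA1 G h⟩
    · exact Finset.mem_sdiff.2 ⟨hG, h⟩
  have hks : ∀ v, Kept v → key v ∈ Gs := fun v hv => (hGs _).2 ⟨v, hv, rfl⟩
  set wt : κ → ℝ := fun c => min (σ c + ∑ M ∈ A.filter (fun M => f M = c), (σ M - L)) (3 * hb)
    with hwt
  have hnn : ∀ M ∈ A, 0 ≤ σ M - L := fun M hM => by linarith [(hσ M (hI (hAI hM))).1]
  have hbL : ∀ G ∈ Gs, L ≤ hb := fun G hG => (hσ G hG).1.trans (hσ G hG).2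
  -- diameter
  have hD : ∀ u v, Kept u → Kept v → φ (key u) = φ (key v) →
      ∃ c ≤ wt (φ (key u)), Wk J ω u v c := by
    intro u v hu hv huv
    have hsum0 : ∀ c, 0 ≤ ∑ M ∈ A.filter (fun M => f M = c), (σ M - L) := fun c =>
      Finset.sum_nonneg fun M hM => hnn M (Finset.mem_filter.1 hM).1
    have hbu := hσ _ (hks u hu)
    have hbv := hσ _ (hks v hv)
    by_cases hequ : key u = key v
    · obtain ⟨c, hc, w⟩ := hdiam u v hu hv hequ
      refine ⟨c, hc.trans ?_, w⟩
      apply le_min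
      · by_cases h : key u ∈ A
        · have h1 : φ (key u) = f (key u) := by simp [hφ, h]
          rw [h1]
          have h2 : σ (key u) - L ≤ ∑ M ∈ A.filter (fun M => f M = f (key u)), (σ M - L) :=
            Finset.single_le_sum (f := fun M => σ M - L)
              (fun M hM => hnn M (Finset.mem_filter.1 hM).1) (by simp [h])
          linarith [(hσ _ (hfG _ h)).1]
        · have h1 : φ (key u) = key u := by simp [hφ, h]
          rw [h1]
          linarith [hsum0 (key u)]
      · linarith
    by_cases h : key u ∈ A <;> by_cases h' : key v ∈ A
    · have h1 : φ (key u) = f (key u) := by simp [hφ, h]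
      have h1' : φ (key v) = f (key v) := by simp [hφ, h']
      rw [h1, h1'] at huv
      rw [h1]
      obtain ⟨g1, -, g2⟩ := hg _ (hAI h)
      obtain ⟨g1', -, g2'⟩ := hg _ (hAI h')
      obtain ⟨c1, hc1, w1⟩ := g2 u hu rfl
      obtain ⟨c2, hc2, w2⟩ := g2' v hv rfl
      obtain ⟨c3, hc3, w3⟩ := hdiam _ _ g1 g1' huv
      refine ⟨_, ?_, (w1.concat w3).concat (w2.symm hJ)⟩
      have hb3 := (hσ _ (hfG _ h))
      change c3 ≤ σ (f (key u)) at hc3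
      apply le_min
      · have h2 : ∑ M ∈ {key u, key v}, (σ M - L) ≤
            ∑ M ∈ A.filter (fun M => f M = f (key u)), (σ M - L) := by
          apply Finset.sum_le_sum_of_subset_of_nonneg
          · intro M hM
            simp only [Finset.mem_insert, Finset.mem_singleton] at hM
            rcases hM with rfl | rfl
            · simp [h]
            · simp [h', huv]
          · intro M hM _
            exact hnn M (Finset.mem_filter.1 hM).1
        rw [Finset.sum_pair hequ] at h2
        linarith
      · linarith
    · have h1 : φ (key u) = f (key u) := by simp [hφ, h]
      have h1' : φ (key v) = key v := by simp [hφ, h']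
      rw [h1, h1'] at huv
      rw [h1]
      obtain ⟨g1, -, g2⟩ := hg _ (hAI h)
      obtain ⟨c1, hc1, w1⟩ := g2 u hu rfl
      obtain ⟨c3, hc3, w3⟩ := hdiam _ _ g1 hv huv
      refine ⟨_, ?_, (w1.concat w3)⟩
      have hb3 := (hσ _ (hfG _ h))
      change c3 ≤ σ (f (key u)) at hc3
      apply le_min
      · have h2 : σ (key u) - L ≤ ∑ M ∈ A.filter (fun M => f M = f (key u)), (σ M - L) :=
          Finset.single_le_sum (f := fun M => σ M - L)
            (fun M hM => hnn M (Finset.mem_filter.1 hM).1) (by simp [h])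
        linarith
      · linarith
    · have h1 : φ (key u) = key u := by simp [hφ, h]
      have h1' : φ (key v) = f (key v) := by simp [hφ, h']
      rw [h1, h1'] at huv
      rw [h1, huv]
      obtain ⟨g1, -, g2⟩ := hg _ (hAI h')
      obtain ⟨c1, hc1, w1⟩ := g2 v hv rfl
      obtain ⟨c3, hc3, w3⟩ := hdiam _ _ g1 hu huv.symm
      refine ⟨_, ?_, (w1.concat w3).symm hJ⟩
      have hb3 := (hσ _ (hfG _ h'))
      change c3 ≤ σ (f (key v)) at hc3
      apply le_min
      · have h2 : σ (key v) - L ≤ ∑ M ∈ A.filter (fun M => f M = f (key v)), (σ M - L) :=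
          Finset.single_le_sum (f := fun M => σ M - L)
            (fun M hM => hnn M (Finset.mem_filter.1 hM).1) (by simp [h'])
        linarith
      · linarith
    · exfalso
      have h1 : φ (key u) = key u := by simp [hφ, h]
      have h1' : φ (key v) = key v := by simp [hφ, h']
      rw [h1, h1'] at huv
      exact hequ huv
  let π' : N → {c // c ∈ Gs \ A} := fun v => ⟨φ (key (star v)), hφG _ (hks _ (hstar v))⟩
  have hπ : ∀ v, Kept v → (π' v).1 = φ (key v) := by
    intro v hv
    simp only [π', hstar1 v hv]
  let Adj' : {c // c ∈ Gs \ A} → {c // c ∈ Gs \ A} → Prop := fun c c' =>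
    ∃ a b, Kept a ∧ Kept b ∧ Adj a b ∧ φ (key a) = c.1 ∧ φ (key b) = c'.1
  refine ⟨{c // c ∈ Gs \ A}, inferInstance, Adj', fun c => wt c.1, π', ?_, ?_, ?_, ?_, ?_⟩
  · rintro c c' ⟨a, b, ha, hb, hab, h1, h2⟩
    exact ⟨b, a, hb, ha, hA _ _ hab, h2, h1⟩
  · intro c c'
    have hrep : ∀ c : {c // c ∈ Gs \ A}, ∃ v, Kept v ∧ π' v = c := by
      intro c
      obtain ⟨h1, h2⟩ := Finset.mem_sdiff.1 c.2
      obtain ⟨v, hv, hvc⟩ := (hGs _).1 h1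
      refine ⟨v, hv, Subtype.ext ?_⟩
      rw [hπ v hv, hvc]
      simp [hφ, h2]
    obtain ⟨v, hv, rfl⟩ := hrep c
    obtain ⟨v', hv', rfl⟩ := hrep c'
    refine Relation.ReflTransGen.lift π' ?_ _ _ (hconn v v' hv hv')
    rintro a b ⟨hab, ha, hb⟩
    exact ⟨a, b, ha, hb, hab, (hπ a ha).symm, (hπ b hb).symm⟩
  · rintro ⟨c, hc⟩
    have hc1 := (Finset.mem_sdiff.1 hc).1
    have hsum0 : 0 ≤ ∑ M ∈ A.filter (fun M => f M = c), (σ M - L) :=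
      Finset.sum_nonneg fun M hM => hnn M (Finset.mem_filter.1 hM).1
    have := hσ c hc1
    refine ⟨le_min ?_ ?_, min_le_right _ _⟩ <;> linarith
  · have lift : ∀ (C C' : {c // c ∈ Gs \ A}) (c' : ℝ),
        Wk (HJ Adj') (fun c => wt c.1) C C' c' → ∀ u v, Kept u → Kept v → φ (key u) = C.1 →
        φ (key v) = C'.1 → ∃ c ≤ c', Wk J ω u v c := by
      intro C C' c' hw
      induction hw with
      | nil C =>
        intro u v hu hv h1 h2
        obtain ⟨c, hc, w⟩ := hD u v hu hv (h1.trans h2.symm)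
        rw [h1] at hc
        exact ⟨c, hc, w⟩
      | @cons C C1 C' l c hl _ ih =>
        intro u v hu hv h1 h2
        obtain ⟨⟨a, b, ha, hb, hab, h3, h4⟩, rfl⟩ := hl
        obtain ⟨c1, hc1, w1⟩ := hD u a hu ha (h1.trans h3.symm)
        obtain ⟨c2, hc2, w2⟩ := ih b v hb hv h4 h2
        rw [h1] at hc1
        exact ⟨_, by linarith, w1.app (hAJ _ _ hab) w2⟩
    intro u v c' hw
    obtain ⟨c1, hc1, w1⟩ := hstar2 u
    obtain ⟨c2, hc2, w2⟩ := hstar2 v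
    obtain ⟨c3, hc3, w3⟩ := lift _ _ c' hw (star u) (star v) (hstar u) (hstar v) rfl rfl
    exact ⟨_, by linarith, (w1.concat w3).concat (w2.symm hJ)⟩
  · have h1 : ∑ u : {c // c ∈ Gs \ A}, wt u.1 = ∑ c ∈ Gs \ A, wt c :=
      Finset.sum_coe_sort (Gs \ A) wt
    rw [h1]
    have h2 : ∑ c ∈ Gs \ A, wt c ≤
        ∑ c ∈ Gs \ A, (σ c + ∑ M ∈ A.filter (fun M => f M = c), (σ M - L)) :=
      Finset.sum_le_sum fun c _ => min_le_left _ _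
    rw [Finset.sum_add_distrib, Finset.sum_fiberwise_of_maps_to (s := A) (t := Gs \ A) (g := f)
      (fun M hM => Finset.mem_sdiff.2 ⟨hfG M hM, hA1 M hM⟩) (fun M => σ M - L)] at h2
    have h3 := Finset.sum_sdiff (hAI.trans hI) (f := σ)
    rw [Finset.sum_sub_distrib, Finset.sum_const, nsmul_eq_mul] at h2
    have h4 : (I.card : ℝ) ≤ 3 * A.card := by exact_mod_cast hA2
    nlinarith


/-- Kept nodes. -/
def Kp {N : Type} (d : N → N) (h Tm : N → ℝ) (L : ℝ) (v : N) : Prop :=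
  2 * L ≤ h v ∧ 4 * L ≤ Tm (d v)

/-- Context for the contraction step. -/
structure SC {N : Type} (Adj : N → N → Prop) (ω : N → ℝ) (o : N) (par : N → N) (rk : N → ℕ)
    (d : N → N) (h : N → ℝ) (Tm : N → ℝ) (star : N → N) (cl : N → ℝ) (lo e L : ℝ) : Prop where
  P : LPD Adj ω o par rk d h
  hA : ∀ u v, Adj u v → Adj v u
  lo0 : 0 < lo
  hlo : ∀ v, lo ≤ ω v
  he : ∀ v, ω v ≤ e
  eL : 100 * e ≤ L
  T1 : ∀ w, h w + ω w ≤ Tm (d w)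
  T2 : ∀ v, ∃ w, d w = d v ∧ Tm (d v) = h w + ω w
  root : 4 * L ≤ h o + ω o
  st1 : ∀ v, Kp d h Tm L v → star v = v ∧ cl v = 0
  st2 : ∀ v, ¬ Kp d h Tm L v → v ≠ o ∧ star v = star (par v) ∧ cl v = ω v + cl (par v)

section SClemmas
variable {N : Type} {Adj : N → N → Prop} {ω : N → ℝ} {o : N} {par : N → N}
  {rk : N → ℕ} {d : N → N} {h Tm : N → ℝ} {star : N → N} {cl : N → ℝ} {lo e L : ℝ}

theorem SC.pos (S : SC Adj ω o par rk d h Tm star cl lo e L) (v : N) : 0 < ω v :=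
  S.lo0.trans_le (S.hlo v)

theorem SC.e0 (S : SC Adj ω o par rk d h Tm star cl lo e L) : 0 < e :=
  (S.pos o).trans_le (S.he o)

theorem SC.L0 (S : SC Adj ω o par rk d h Tm star cl lo e L) : 0 < L := by
  linarith [S.eL, S.e0]

theorem SC.kroot (S : SC Adj ω o par rk d h Tm star cl lo e L) : Kp d h Tm L o :=
  ⟨by linarith [S.eL, S.e0, S.he o, S.root], S.root.trans (S.T1 o)⟩

theorem SC.kpar (S : SC Adj ω o par rk d h Tm star cl lo e L) (v : N) (hv : Kp d h Tm L v)
    (ho : v ≠ o) : Kp d h Tm L (par v) := by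
  have h2 := S.P.h2 v ho
  refine ⟨by linarith [hv.1, S.pos v], ?_⟩
  by_cases hd : d (par v) = d v
  · rw [hd]; exact hv.2
  obtain ⟨w, hw1, hw2⟩ := S.T2 v
  have hwv : h w ≤ h v := by
    by_contra hlt
    exact hd (S.P.h4 v w hw1.symm (not_le.1 hlt)).2.1
  have : 4 * L ≤ h v + ω v := by
    rcases hwv.eq_or_lt with he | hl
    · have := S.P.h5 w v hw1 he
      subst this
      linarith [hv.2]
    · obtain ⟨h3, h4, h5⟩ := S.P.h4 w v hw1 hl
      have := S.P.h3 w h3 h4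
      linarith [hv.2, S.pos v]
  linarith [S.T1 (par v), S.pos (par v)]

theorem SC.dead (S : SC Adj ω o par rk d h Tm star cl lo e L) (v : N) (hv : ¬ Kp d h Tm L v) :
    h v + ω v ≤ 4 * L := by
  unfold Kp at hv
  by_contra hc
  exact hv ⟨by linarith [S.eL, S.e0, S.he v], by linarith [S.T1 v]⟩

theorem SC.kstar (S : SC Adj ω o par rk d h Tm star cl lo e L) (v : N) :
    Kp d h Tm L (star v) ∧ Wk (HJ Adj) ω v (star v) (cl v + ω (star v)) ∧ 0 ≤ cl v ∧
      (¬ Kp d h Tm L v → h v + cl v ≤ 4 * L) := by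
  have key : ∀ n v, rk v = n → Kp d h Tm L (star v) ∧
      Wk (HJ Adj) ω v (star v) (cl v + ω (star v)) ∧ 0 ≤ cl v ∧
      (¬ Kp d h Tm L v → h v + cl v ≤ 4 * L) := by
    intro n
    induction n using Nat.strong_induction_on with
    | _ n ih =>
    intro v hn
    by_cases hv : Kp d h Tm L v
    · obtain ⟨h1, h2⟩ := S.st1 v hv
      rw [h1, h2]
      exact ⟨hv, by simpa using Wk.nil (J := HJ Adj) (ω := ω) v, le_rfl, fun h => absurd hv h⟩
    · obtain ⟨h1, h2, h3⟩ := S.st2 v hv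
      obtain ⟨i1, i2, i3, i4⟩ := ih _ (hn ▸ S.P.rkl v h1) (par v) rfl
      rw [h2, h3]
      refine ⟨i1, ?_, by linarith [S.pos v], fun _ => ?_⟩
      · have := Wk.cons (⟨S.P.adj v h1, rfl⟩ : HJ Adj v (par v) 0) i2
        convert this using 1
        ring
      · by_cases hp : Kp d h Tm L (par v)
        · rw [(S.st1 _ hp).2]
          linarith [S.dead v hv]
        · linarith [i4 hp, S.P.h2 v h1]
  exact key _ v rfl

theorem SC.cl4 (S : SC Adj ω o par rk d h Tm star cl lo e L) (v : N) : cl v ≤ 4 * L := by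
  by_cases hv : Kp d h Tm L v
  · rw [(S.st1 _ hv).2]; linarith [S.L0]
  · linarith [(S.kstar v).2.2.2 hv, S.P.h0 v]

theorem SC.clsum [Fintype N] (S : SC Adj ω o par rk d h Tm star cl lo e L) (v : N)
    [DecidablePred (fun w => ¬ Kp d h Tm L w ∧ star w = star v)] :
    cl v ≤ ∑ w ∈ Finset.univ.filter (fun w => ¬ Kp d h Tm L w ∧ star w = star v), ω w := by
  classical
  have key : ∀ n v, rk v = n → cl v ≤ ∑ w ∈ Finset.univ.filter
      (fun w => (¬ Kp d h Tm L w ∧ star w = star v) ∧ rk w ≤ rk v), ω w := by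
    intro n
    induction n using Nat.strong_induction_on with
    | _ n ih =>
    intro v hn
    by_cases hv : Kp d h Tm L v
    · obtain ⟨h1, h2⟩ := S.st1 v hv
      rw [h2]
      exact Finset.sum_nonneg fun w _ => (S.pos w).le
    · obtain ⟨h1, h2, h3⟩ := S.st2 v hv
      have i := ih _ (hn ▸ S.P.rkl v h1) (par v) rfl
      have hnot : v ∉ Finset.univ.filter
          (fun w => (¬ Kp d h Tm L w ∧ star w = star (par v)) ∧ rk w ≤ rk (par v)) := by
        intro hm
        have := (Finset.mem_filter.1 hm).2.2
        have := S.P.rkl v h1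
        omega
      calc cl v = ω v + cl (par v) := h3
        _ ≤ ω v + _ := by gcongr
        _ = _ := (Finset.sum_insert (f := ω) hnot).symm
        _ ≤ _ := by
          apply Finset.sum_le_sum_of_subset_of_nonneg
          · intro w hw
            rcases Finset.mem_insert.1 hw with rfl | hw
            · simp [hv]
            · simp only [Finset.mem_filter, Finset.mem_univ, true_and] at hw ⊢
              have := S.P.rkl v h1
              exact ⟨⟨hw.1.1, hw.1.2.trans h2.symm⟩, by omega⟩
          · intro w _ _
            exact (S.pos w).le
  refine (key _ v rfl).trans ?_
  apply Finset.sum_le_sum_of_subset_of_nonneg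
  · intro w hw
    simp only [Finset.mem_filter, Finset.mem_univ, true_and] at hw ⊢
    exact hw.1
  · intro w _ _
    exact (S.pos w).le

theorem SC.kconn (S : SC Adj ω o par rk d h Tm star cl lo e L) (u v : N)
    (hu : Kp d h Tm L u) (hv : Kp d h Tm L v) :
    Relation.ReflTransGen (fun a b => Adj a b ∧ Kp d h Tm L a ∧ Kp d h Tm L b) u v := by
  have key : ∀ n v, rk v = n → Kp d h Tm L v →
      Relation.ReflTransGen (fun a b => Adj a b ∧ Kp d h Tm L a ∧ Kp d h Tm L b) v o := by
    intro n
    induction n using Nat.strong_induction_on with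
    | _ n ih =>
    intro v hn hv
    by_cases ho : v = o
    · rw [ho]
    · have hp := S.kpar v hv ho
      exact Relation.ReflTransGen.head ⟨S.P.adj v ho, hv, hp⟩
        (ih _ (hn ▸ S.P.rkl v ho) (par v) rfl hp)
  refine (key _ u rfl hu).trans ?_
  have hsym : Std.Symm (fun a b => Adj a b ∧ Kp d h Tm L a ∧ Kp d h Tm L b) :=
    ⟨fun a b hab => ⟨S.hA _ _ hab.1, hab.2.2, hab.2.1⟩⟩
  exact Std.Symm.symm _ _ (key _ v rfl hv)

/-- Group key of a node. -/
noncomputable def gk (d : N → N) (h Tm : N → ℝ) (L : ℝ) (j : ℕ) (v : N) : N × ℕ :=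
  (d v, blk (30 * L) (Tm (d v) - 2 * L) j (h v - 2 * L))

theorem SC.gconv (S : SC Adj ω o par rk d h Tm star cl lo e L) {j : ℕ} {u v w : N}
    (hu : Kp d h Tm L u) (huv : gk d h Tm L j u = gk d h Tm L j v) (hd : d w = d u)
    (h1 : h u ≤ h w) (h2 : h w ≤ h v) : Kp d h Tm L w ∧ gk d h Tm L j w = gk d h Tm L j u := by
  have hL := S.L0
  refine ⟨⟨hu.1.trans h1, by rw [hd]; exact hu.2⟩, ?_⟩
  unfold gk at huv ⊢
  have e1 : d u = d v := (Prod.ext_iff.1 huv).1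
  have e2 := (Prod.ext_iff.1 huv).2
  simp only at e2
  rw [← e1] at e2
  rw [hd]
  congr 1
  have hm := blk_mono (by linarith : 0 < 30 * L) (Tm (d u) - 2 * L) j
  apply le_antisymm
  · rw [e2]; exact hm (by linarith)
  · exact hm (by linarith)

/-- Weight of a group. -/
noncomputable def sG [Fintype N] (ω : N → ℝ) (d : N → N) (h Tm : N → ℝ) (L : ℝ) (j : ℕ)
    (G : N × ℕ) : ℝ :=
  open Classical in
  ∑ w ∈ Finset.univ.filter (fun w => Kp d h Tm L w ∧ gk d h Tm L j w = G), ω w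

theorem SC.g_le [Fintype N] (S : SC Adj ω o par rk d h Tm star cl lo e L) {j : ℕ} {u v : N}
    (hu : Kp d h Tm L u) (huv : gk d h Tm L j u = gk d h Tm L j v) (h1 : h u ≤ h v) :
    h v + ω v - h u ≤ sG ω d h Tm L j (gk d h Tm L j u) := by
  classical
  have hd : d u = d v := (Prod.ext_iff.1 huv).1
  rw [← S.P.sum S.pos u v hd h1]
  unfold sG
  apply Finset.sum_le_sum_of_subset_of_nonneg
  · intro w hw
    simp only [Finset.mem_filter, Finset.mem_univ, true_and] at hw ⊢
    exact S.gconv hu huv (hw.1.trans hd.symm) hw.2.1 hw.2.2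
  · intro w _ _
    exact (S.pos w).le

theorem SC.g_up [Fintype N] (S : SC Adj ω o par rk d h Tm star cl lo e L) {j : ℕ} (hj : j < 3)
    (G : N × ℕ) : sG ω d h Tm L j G ≤ 91 * L := by
  classical
  unfold sG
  set A := Finset.univ.filter (fun w => Kp d h Tm L w ∧ gk d h Tm L j w = G) with hAdef
  have hL := S.L0
  rcases A.eq_empty_or_nonempty with h0 | hne
  · rw [h0]; simp; linarith
  obtain ⟨u, hu, hu'⟩ := Finset.exists_min_image A h hne
  have hmem : ∀ w ∈ A, Kp d h Tm L w ∧ gk d h Tm L j w = G := by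
    intro w hw
    simpa [hAdef] using hw
  have := S.P.sum_le S.pos S.he A (d u) (h u) (h u + 90 * L) (by
    intro w hw
    have e0 : gk d h Tm L j w = gk d h Tm L j u := (hmem w hw).2.trans (hmem u hu).2.symm
    have e1 : d w = d u := (Prod.ext_iff.1 e0).1
    have e2 := (Prod.ext_iff.1 e0).2
    simp only [gk] at e2
    rw [e1] at e2
    refine ⟨e1, hu' w hw, ?_⟩
    have := blk_diam (by linarith : 0 < 30 * L) hj (y := h u - 2 * L) (y' := h w - 2 * L)
      (m := Tm (d u) - 2 * L)
      (by linarith [(hmem u hu).1.1]) (by linarith [S.T1 w, S.pos w, e1 ▸ S.T1 w]) e2.symm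
    linarith) (by linarith) S.e0.le
  linarith [S.eL, S.e0]

theorem SC.g_lo [Fintype N] (S : SC Adj ω o par rk d h Tm star cl lo e L) {j : ℕ}
    (v : N) (hv : Kp d h Tm L v) : 2 * L - e ≤ sG ω d h Tm L j (gk d h Tm L j v) := by
  have hL := S.L0
  have hT := S.T1 v
  have hp := S.pos v
  obtain ⟨a, b, h1, h2, h3, h4, h5, h6⟩ := blk_ext (by linarith : 0 < 30 * L)
    (j := j) (y := h v - 2 * L) (m := Tm (d v) - 2 * L) (by linarith [hv.1]) (by linarith)
  have h5' : 2 * L ≤ b - a := by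
    refine le_trans (le_min ?_ ?_) h5
    · linarith [hv.2]
    · linarith
  obtain ⟨p, p1, p2, p3, y, y1, y2, y3⟩ := S.P.bot S.pos v (2 * L + a) (by linarith) (by linarith)
  obtain ⟨t, t1, t2⟩ := S.T2 v
  obtain ⟨q, q1, q2, q3, q4⟩ := S.P.tile S.pos p t (p1.trans t1.symm) (2 * L + b)
    (by linarith) (by linarith)
  have hgk : ∀ w, d w = d v → h p ≤ h w → h w < 2 * L + b →
      gk d h Tm L j w = gk d h Tm L j v := by
    intro w w1 w2 w3
    unfold gk
    rw [w1, h6 (h w - 2 * L) (by linarith) (by linarith)]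
  have e1 := hgk p p1 le_rfl (by linarith)
  have e2 := hgk q (q1.trans p1) q2 q3
  have := S.g_le (j := j) (u := p) (v := q) ⟨by linarith, by rw [p1]; exact hv.2⟩
    (e1.trans e2.symm) q2
  rw [e1] at this
  linarith [S.he y]

/-- Walks inside a group. -/
theorem SC.g_walk [Fintype N] (S : SC Adj ω o par rk d h Tm star cl lo e L) {j : ℕ} {u v : N}
    (hu : Kp d h Tm L u) (hv : Kp d h Tm L v) (huv : gk d h Tm L j u = gk d h Tm L j v) :
    ∃ c ≤ sG ω d h Tm L j (gk d h Tm L j u), Wk (HJ Adj) ω u v c := by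
  have hd : d u = d v := (Prod.ext_iff.1 huv).1
  rcases le_total (h u) (h v) with h1 | h1
  · exact ⟨_, S.g_le hu huv h1, S.P.walk u v hd h1⟩
  · refine ⟨_, ?_, (S.P.walk v u hd.symm h1).symm (HJ.symm S.hA)⟩
    rw [huv]
    exact S.g_le hv huv.symm h1

/-- Walks from an interior node. -/
theorem SC.g_int [Fintype N] (S : SC Adj ω o par rk d h Tm star cl lo e L) {j : ℕ} {b u : N}
    (hb : Kp d h Tm L b) (hu : Kp d h Tm L u) (hub : gk d h Tm L j u = gk d h Tm L j b)
    (hb1 : 12 * L ≤ h b) (hb2 : h b + 10 * L ≤ Tm (d b))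
    (hwin : ∀ y', |y' - (h b - 2 * L)| < 10 * L →
      blk (30 * L) (Tm (d b) - 2 * L) j y' = blk (30 * L) (Tm (d b) - 2 * L) j (h b - 2 * L)) :
    ∃ c ≤ sG ω d h Tm L j (gk d h Tm L j b) - 9 * L, Wk (HJ Adj) ω u b c := by
  have hd : d u = d b := (Prod.ext_iff.1 hub).1
  have hL := S.L0
  have heL := S.eL
  have he0 := S.e0
  have hgk : ∀ w, d w = d b → |h w - h b| < 10 * L → gk d h Tm L j w = gk d h Tm L j b := by
    intro w w1 w2
    unfold gk
    rw [w1, hwin (h w - 2 * L) (by convert w2 using 2; ring)]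
  rcases le_total (h u) (h b) with h1 | h1
  · obtain ⟨t, t1, t2⟩ := S.T2 b
    obtain ⟨q, q1, q2, q3, q4⟩ := S.P.tile S.pos b t t1.symm (h b + 19 / 2 * L)
      (by linarith) (by linarith)
    have e1 := hgk q q1 (by rw [abs_lt]; constructor <;> linarith)
    refine ⟨_, ?_, S.P.walk u b hd h1⟩
    have := S.g_le (j := j) (u := u) (v := q) hu (hub.trans e1.symm) (h1.trans q2)
    rw [hub] at this
    linarith [S.he b]
  · obtain ⟨p, p1, p2, p3, y, y1, y2, y3⟩ := S.P.bot S.pos b (h b - 19 / 2 * L)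
      (by linarith) (by linarith)
    have e1 := hgk p p1 (by rw [abs_lt]; constructor <;> linarith)
    refine ⟨_, ?_, (S.P.walk b u hd.symm h1).symm (HJ.symm S.hA)⟩
    have := S.g_le (j := j) (u := p) (v := u) ⟨by linarith, by rw [p1]; exact hb.2⟩
      (e1.trans hub.symm) (p3.trans h1)
    rw [e1] at this
    linarith [S.he y]

/-- A shortcut inside a group reduces its diameter. -/
theorem SC.g_short [Fintype N] (S : SC Adj ω o par rk d h Tm star cl lo e L) {j : ℕ}
    {J : N → N → ℝ → Prop} (hJ : ∀ u v l, J u v l → J v u l)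
    (hAJ : ∀ u v l, HJ Adj u v l → J u v l) {x y : N} (hx : Kp d h Tm L x) (hy : Kp d h Tm L y)
    (hxy : gk d h Tm L j x = gk d h Tm L j y) {c0 : ℝ} (hw : Wk J ω x y c0)
    (hc0 : c0 + 33 * e ≤ h y - h x) (hc00 : 0 ≤ c0) {u v : N} (hu : Kp d h Tm L u) (hv : Kp d h Tm L v)
    (hux : gk d h Tm L j u = gk d h Tm L j x) (hvx : gk d h Tm L j v = gk d h Tm L j x) :
    ∃ c ≤ sG ω d h Tm L j (gk d h Tm L j x) - e, Wk J ω u v c := by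
  have he0 := S.e0
  have walk : ∀ a b : N, d a = d b → ∃ c, Wk J ω a b c ∧
      (h a ≤ h b → c = h b + ω b - h a) ∧ (h b ≤ h a → c = h a + ω a - h b) := by
    intro a b hab
    rcases le_total (h a) (h b) with h1 | h1
    · refine ⟨_, (S.P.walk a b hab h1).mono hAJ, fun _ => rfl, fun h2 => ?_⟩
      have := S.P.h5 a b hab (le_antisymm h1 h2)
      rw [this]
    · refine ⟨_, ((S.P.walk b a hab.symm h1).mono hAJ).symm hJ, fun h2 => ?_, fun _ => rfl⟩
      have := S.P.h5 a b hab (le_antisymm h2 h1)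
      rw [this]
  have main : ∀ u v : N, Kp d h Tm L u → Kp d h Tm L v → gk d h Tm L j u = gk d h Tm L j x →
      gk d h Tm L j v = gk d h Tm L j x → h u ≤ h v →
      ∃ c ≤ sG ω d h Tm L j (gk d h Tm L j x) - e, Wk J ω u v c := by
    intro u v hu hv hux hvx huv
    have d1 : d u = d x := (Prod.ext_iff.1 hux).1
    have d2 : d v = d x := (Prod.ext_iff.1 hvx).1
    have d3 : d x = d y := (Prod.ext_iff.1 hxy).1
    by_cases hc : h v + ω v - h u ≤ sG ω d h Tm L j (gk d h Tm L j x) - e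
    · exact ⟨_, hc, (S.P.walk u v (d1.trans d2.symm) huv).mono hAJ⟩
    push Not at hc
    -- bounds on sG by pairs
    have b1 : h x ≤ h v → h v + ω v - h x ≤ sG ω d h Tm L j (gk d h Tm L j x) := fun hle =>
      S.g_le hx hvx.symm hle
    have b2 : h u ≤ h y → h y + ω y - h u ≤ sG ω d h Tm L j (gk d h Tm L j x) := fun hle => by
      rw [← hux]; exact S.g_le hu (hux.trans hxy) hle
    have b3 : h y + ω y - h x ≤ sG ω d h Tm L j (gk d h Tm L j x) :=
      S.g_le hx hxy (by linarith)
    have b4 : h v + ω v - h u ≤ sG ω d h Tm L j (gk d h Tm L j x) := by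
      rw [← hux]; exact S.g_le hu (hux.trans hvx.symm) huv
    obtain ⟨c1, w1, i1, i2⟩ := walk u x d1
    obtain ⟨c2, w2, k1, k2⟩ := walk y v (d3.symm.trans d2.symm)
    refine ⟨_, ?_, (w1.concat hw).concat w2⟩
    have := S.pos x
    have := S.pos y
    have := S.pos u
    have := S.pos v
    have := S.he x
    have := S.he y
    have := S.he u
    have := S.he v
    rcases le_or_gt (h u) (h x) with q1 | q1 <;> rcases le_or_gt (h y) (h v) with q2 | q2
    · have := i1 q1
      have := k1 q2
      linarith
    · have := i1 q1
      have := k2 q2.le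
      have := b2 (by linarith)
      linarith
    · have := i2 q1.le
      have := k1 q2
      have := b1 (by linarith)
      linarith
    · have := i2 q1.le
      have := k2 q2.le
      linarith
  rcases le_total (h u) (h v) with h1 | h1
  · exact main u v hu hv hux hvx h1
  · obtain ⟨c, hc, w⟩ := main v u hv hu hvx hux h1
    exact ⟨c, hc, w.symm hJ⟩

end SClemmas


theorem fib_le {ι κ : Type*} [DecidableEq κ] (t : Finset ι) (s : Finset κ) (g : ι → κ) (f : ι → ℝ)
    (hf : ∀ i ∈ t, 0 ≤ f i) :
    ∑ G ∈ s, ∑ i ∈ t.filter (fun i => g i = G), f i ≤ ∑ i ∈ t, f i := by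
  simp_rw [Finset.sum_filter]
  rw [Finset.sum_comm]
  apply Finset.sum_le_sum
  intro i hi
  rw [Finset.sum_ite_eq]
  split_ifs
  · exact le_rfl
  · exact hf i hi

theorem choose_shift {N : Type} (A : Finset N) (Q : ℕ → N → Prop) [∀ j, DecidablePred (Q j)]
    (h : ∀ b ∈ A, ∃ j < 3, Q j b) : ∃ j < 3, A.card ≤ 3 * (A.filter (Q j)).card := by
  classical
  by_contra hcon
  push Not at hcon
  have h0 := hcon 0 (by norm_num)
  have h1 := hcon 1 (by norm_num)
  have h2 := hcon 2 (by norm_num)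
  have hsub : A ⊆ (A.filter (Q 0)) ∪ ((A.filter (Q 1)) ∪ (A.filter (Q 2))) := by
    intro b hb
    obtain ⟨j, hj, hq⟩ := h b hb
    simp only [Finset.mem_union, Finset.mem_filter]
    interval_cases j <;> tauto
  have h3 := Finset.card_le_card hsub
  have h4 := Finset.card_union_le (A.filter (Q 0)) ((A.filter (Q 1)) ∪ (A.filter (Q 2)))
  have h5 := Finset.card_union_le (A.filter (Q 1)) (A.filter (Q 2))
  omega

theorem step_arith (lo e L D i1 i2 i3 nd ne nn nb ng na : ℝ) (lo0 : 0 < lo) (he0 : 0 < e) (hL : 0 < L)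
    (heL : 100 * e ≤ L) (hD0 : 0 ≤ D) (hi1 : 0 ≤ i1) (hi3 : 0 ≤ i3)
    (a4 : lo * nd ≤ D) (a5 : lo * ne ≤ 11 * D) (a6 : lo * nb ≤ 91 * L * ng)
    (a7 : 2 * e * i2 ≤ D) (a8 : ng ≤ i1 + i2 + i3) (a9 : na ≤ nd + ne + nn) (a10 : nn ≤ 3 * nb) :
    lo * e / (1000 * L) * na ≤ D + e * i3 + L / 3 * i1 := by
  have hx : lo * na ≤ 12 * D + 273 * L * (i1 + i2 + i3) := by
    have b1 : lo * na ≤ lo * (nd + ne + 3 * nb) := by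
      gcongr
      linarith
    have b2 : 91 * L * ng ≤ 91 * L * (i1 + i2 + i3) := by gcongr
    nlinarith
  have hη : lo * e / (1000 * L) * na = lo * na * (e / L) / 1000 := by
    field_simp
  have ht : e / L ≤ 1 / 100 := by
    rw [div_le_iff₀ hL]; linarith
  have ht0 : 0 ≤ e / L := by positivity
  have htL : L * (e / L) = e := by field_simp
  have hx2 : lo * na * (e / L) ≤ (12 * D + 273 * L * (i1 + i2 + i3)) * (e / L) := by
    gcongr
  have hx3 : (12 * D + 273 * L * (i1 + i2 + i3)) * (e / L)
      = 12 * (D * (e / L)) + 273 * (e * i1 + e * i2 + e * i3) := by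
    calc _ = 12 * (D * (e / L)) + 273 * ((L * (e / L)) * (i1 + i2 + i3)) := by ring
      _ = _ := by rw [htL]; ring
  have hx4 : D * (e / L) ≤ D * (1 / 100) := by gcongr
  have hx5 : e * i1 ≤ L / 100 * i1 := by
    gcongr
    linarith
  have hx6 : 0 ≤ e * i3 := by positivity
  have hx7 : 0 ≤ L * i1 := by positivity
  rw [hη]
  linarith

section SClemmas2
variable {N : Type} [Fintype N] {Adj : N → N → Prop} {ω : N → ℝ} {o : N} {par : N → N}
  {rk : N → ℕ} {d : N → N} {h Tm : N → ℝ} {star : N → N} {cl : N → ℝ} {lo e L : ℝ}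

theorem SC.card_le (S : SC Adj ω o par rk d h Tm star cl lo e L) (A : Finset N) :
    lo * A.card ≤ ∑ w ∈ A, ω w := by
  have := Finset.card_nsmul_le_sum A ω lo (fun w _ => S.hlo w)
  rw [nsmul_eq_mul] at this
  linarith

open Classical in
theorem SC.end_le (S : SC Adj ω o par rk d h Tm star cl lo e L) :
    ∑ w ∈ Finset.univ.filter (fun w => Kp d h Tm L w ∧ (h w < 12 * L ∨ Tm (d w) < h w + 10 * L)), ω w
      ≤ 11 * ∑ w ∈ Finset.univ.filter (fun w => ¬ Kp d h Tm L w), ω w := by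
  have hL := S.L0
  have heL := S.eL
  have he0 := S.e0
  rw [← Finset.sum_fiberwise (Finset.univ.filter (fun w => Kp d h Tm L w ∧
    (h w < 12 * L ∨ Tm (d w) < h w + 10 * L))) d ω,
    ← Finset.sum_fiberwise (Finset.univ.filter (fun w => ¬ Kp d h Tm L w)) d ω, Finset.mul_sum]
  apply Finset.sum_le_sum
  intro x _
  by_cases hx : ∃ v, Kp d h Tm L v ∧ d v = x
  · obtain ⟨v, hv, rfl⟩ := hx
    have h1 : 2 * L ≤ ∑ w ∈ (Finset.univ.filter (fun w => ¬ Kp d h Tm L w)).filter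
        (fun w => d w = d v), ω w := by
      refine (S.P.low_sum S.pos v (2 * L) (by linarith) hv.1).trans ?_
      apply Finset.sum_le_sum_of_subset_of_nonneg
      · intro w hw
        simp only [Finset.mem_filter, Finset.mem_univ, true_and] at hw ⊢
        exact ⟨fun hk => absurd hk.1 (not_le.2 hw.2), hw.1⟩
      · intro w _ _
        exact (S.pos w).le
    have h2 := S.P.sum_le S.pos S.he (Finset.univ.filter
      (fun w => d w = d v ∧ 2 * L ≤ h w ∧ h w ≤ 12 * L)) (d v) (2 * L) (12 * L) (by simp)
      (by linarith) S.e0.le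
    have h3 := S.P.sum_le S.pos S.he (Finset.univ.filter
      (fun w => d w = d v ∧ Tm (d v) - 10 * L ≤ h w ∧ h w ≤ Tm (d v))) (d v) (Tm (d v) - 10 * L)
      (Tm (d v)) (by simp) (by linarith) S.e0.le
    have h4 : ∑ w ∈ (Finset.univ.filter (fun w => Kp d h Tm L w ∧
        (h w < 12 * L ∨ Tm (d w) < h w + 10 * L))).filter (fun w => d w = d v), ω w ≤
        ∑ w ∈ (Finset.univ.filter
      (fun w => d w = d v ∧ 2 * L ≤ h w ∧ h w ≤ 12 * L)) ∪ (Finset.univ.filter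
      (fun w => d w = d v ∧ Tm (d v) - 10 * L ≤ h w ∧ h w ≤ Tm (d v))), ω w := by
      apply Finset.sum_le_sum_of_subset_of_nonneg
      · intro w hw
        simp only [Finset.mem_filter, Finset.mem_univ, true_and, Finset.mem_union] at hw ⊢
        obtain ⟨⟨k1, k2⟩, k3⟩ := hw
        have k4 := S.T1 w
        have k5 := S.pos w
        rw [k3] at k2 k4
        rcases k2 with k2 | k2
        · exact Or.inl ⟨k3, k1.1, k2.le⟩
        · exact Or.inr ⟨k3, by linarith, by linarith⟩
      · intro w _ _
        exact (S.pos w).le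
    have h5 := Finset.sum_union_inter (f := ω) (s₁ := Finset.univ.filter
      (fun w => d w = d v ∧ 2 * L ≤ h w ∧ h w ≤ 12 * L)) (s₂ := Finset.univ.filter
      (fun w => d w = d v ∧ Tm (d v) - 10 * L ≤ h w ∧ h w ≤ Tm (d v)))
    have h6 : 0 ≤ ∑ w ∈ (Finset.univ.filter
      (fun w => d w = d v ∧ 2 * L ≤ h w ∧ h w ≤ 12 * L)) ∩ (Finset.univ.filter
      (fun w => d w = d v ∧ Tm (d v) - 10 * L ≤ h w ∧ h w ≤ Tm (d v))), ω w :=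
      Finset.sum_nonneg fun w _ => (S.pos w).le
    linarith
  · rw [Finset.sum_eq_zero]
    · exact mul_nonneg (by norm_num) (Finset.sum_nonneg fun w _ => (S.pos w).le)
    · intro w hw
      simp only [Finset.mem_filter, Finset.mem_univ, true_and] at hw
      exact absurd ⟨w, hw.1.1, hw.2⟩ hx

set_option maxHeartbeats 1600000 in
open Classical in
theorem SC.step (S : SC Adj ω o par rk d h Tm star cl lo e L) (act : N → N → ℝ → Prop)
    (hsym : ∀ u v l, act u v l → act v u l)
    (hact : ∀ a b l, act a b l → 0 ≤ l ∧ l ≤ 4 * L ∧ ∀ c, Wk (HJ Adj) ω a b c → l + 40 * e ≤ c) :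
    ∃ (N' : Type) (_ : Fintype N') (Adj' : N' → N' → Prop) (ω' : N' → ℝ) (π' : N → N'),
      (∀ u v, Adj' u v → Adj' v u) ∧ (∀ u v, Relation.ReflTransGen Adj' u v) ∧
      (∀ u, L ≤ ω' u ∧ ω' u ≤ 3 * (91 * L)) ∧
      (∀ u v c', Wk (HJ Adj') ω' (π' u) (π' v) c' →
        ∃ c ≤ c' + 8 * L, Wk (EJ Adj act) ω u v c) ∧
      ∑ u, ω' u + lo * e / (1000 * L) * (Finset.univ.filter (fun a => ∃ b l, act a b l)).card
        ≤ ∑ u, ω u := by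
  have hL := S.L0
  have heL := S.eL
  have he0 := S.e0
  have hEJs := EJ.symm (Adj := Adj) (act := act) S.hA hsym
  have hHE : ∀ u v l, HJ Adj u v l → EJ Adj act u v l := fun _ _ _ h => Or.inl h
  set Ac := Finset.univ.filter (fun a => ∃ b l, act a b l) with hAc
  set Dd := Finset.univ.filter (fun w => ¬ Kp d h Tm L w) with hDd
  set En := Finset.univ.filter
    (fun w => Kp d h Tm L w ∧ (h w < 12 * L ∨ Tm (d w) < h w + 10 * L)) with hEn
  set NE := Finset.univ.filter (fun b => (∃ a l, act b a l) ∧ Kp d h Tm L b ∧ 12 * L ≤ h b ∧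
    h b + 10 * L ≤ Tm (d b)) with hNE
  set Q : ℕ → N → Prop := fun j b => ∀ y', |y' - (h b - 2 * L)| < 10 * L →
      blk (30 * L) (Tm (d b) - 2 * L) j y' = blk (30 * L) (Tm (d b) - 2 * L) j (h b - 2 * L)
    with hQ
  obtain ⟨j, hj, hcard⟩ := choose_shift NE Q (by
    intro b hb
    simp only [hNE, Finset.mem_filter, Finset.mem_univ, true_and] at hb
    obtain ⟨j, hj, hj'⟩ := blk_win (by linarith : 0 < 30 * L) (Tm (d b) - 2 * L)
      (y := h b - 2 * L) (by linarith [hb.2.1.1])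
    refine ⟨j, hj, fun y' hy' => hj' y' ?_⟩
    convert hy' using 1
    ring)
  set B := NE.filter (Q j) with hB
  have hBm : ∀ b ∈ B, (∃ a l, act b a l) ∧ Kp d h Tm L b ∧ 12 * L ≤ h b ∧
    h b + 10 * L ≤ Tm (d b) ∧ Q j b := by
    intro b hb
    simp only [hB, hNE, Finset.mem_filter, Finset.mem_univ, true_and] at hb
    tauto
  set k := gk d h Tm L j with hk
  set s := sG ω d h Tm L j with hs
  set GB := B.image k with hGB
  have hch : ∀ G, ∃ (b a : N) (l : ℝ), G ∈ GB → b ∈ B ∧ k b = G ∧ act b a l := by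
    intro G
    by_cases hG : G ∈ GB
    · obtain ⟨b, hb, hbG⟩ := Finset.mem_image.1 hG
      obtain ⟨a, l, hal⟩ := (hBm b hb).1
      exact ⟨b, a, l, fun _ => ⟨hb, hbG, hal⟩⟩
    · exact ⟨o, o, 0, fun h => absurd h hG⟩
  choose bb aa ll hch using hch
  set I := GB.filter (fun G => k (star (aa G)) ≠ G) with hI
  set IIa := GB.filter (fun G => k (star (aa G)) = G ∧ 2 * e ≤ cl (aa G)) with hIIa
  set IIb := GB.filter (fun G => k (star (aa G)) = G ∧ cl (aa G) < 2 * e) with hIIb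
  set σ : N × ℕ → ℝ := fun G => if G ∈ IIb then s G - e else s G with hσ
  set Gs := (Finset.univ.filter (Kp d h Tm L)).image k with hGs
  have hGsm : ∀ G, G ∈ Gs ↔ ∃ v, Kp d h Tm L v ∧ k v = G := by
    intro G
    simp [hGs]
  have hGBGs : GB ⊆ Gs := by
    intro G hG
    obtain ⟨b, hb, hbG⟩ := Finset.mem_image.1 hG
    exact (hGsm G).2 ⟨b, (hBm b hb).2.1, hbG⟩
  -- shortcut groups
  have hshort : ∀ G ∈ IIb, ∀ u v, Kp d h Tm L u → Kp d h Tm L v → k u = G → k v = G →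
      ∃ c ≤ s G - e, Wk (EJ Adj act) ω u v c := by
    intro G hG u v hu hv hug hvg
    obtain ⟨hG1, hG2, hG3⟩ := Finset.mem_filter.1 hG
    obtain ⟨c1, c2, c3⟩ := hch G hG1
    obtain ⟨-, kb, -⟩ := hBm _ c1
    set b := bb G
    set a := aa G
    set l := ll G
    obtain ⟨l0, l4, lw⟩ := hact _ _ _ c3
    obtain ⟨ks, ws, cs, -⟩ := S.kstar a
    have hkk : k b = k (star a) := c2.trans hG2.symm
    have hdd : d b = d (star a) := (Prod.ext_iff.1 hkk).1
    have wE : Wk (EJ Adj act) ω b (star a) (ω b + l + (cl a + ω (star a))) :=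
      Wk.cons (Or.inr c3) (HJ.toEJ ws)
    have := S.he b
    have := S.he (star a)
    have := S.pos b
    have := S.pos (star a)
    rcases le_total (h b) (h (star a)) with hle | hle
    · have w1 := S.P.walk b (star a) hdd hle
      have w2 := lw _ (w1.concat (ws.symm (HJ.symm S.hA)))
      obtain ⟨c, hc, w⟩ := S.g_short (j := j) hEJs hHE kb ks hkk wE (by linarith) (by linarith) hu hv
        (hug.trans c2.symm) (hvg.trans c2.symm)
      refine ⟨c, ?_, w⟩
      rw [← c2]
      exact hc
    · have w1 := (S.P.walk (star a) b hdd.symm hle).symm (HJ.symm S.hA)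
      have w2 := lw _ (w1.concat (ws.symm (HJ.symm S.hA)))
      obtain ⟨c, hc, w⟩ := S.g_short (j := j) hEJs hHE ks kb hkk.symm (wE.symm hEJs)
        (by linarith) (by linarith) hu hv (hug.trans hG2.symm) (hvg.trans hG2.symm)
      refine ⟨c, ?_, w⟩
      rw [← hG2]
      exact hc
  obtain ⟨N', iN, Adj', ω', π', m1, m2, m3, m4, m5⟩ := merge_lemma Adj S.hA (EJ Adj act) hEJs
    (fun u v huv => Or.inl ⟨huv, rfl⟩) ω L (91 * L) hL.le (Kp d h Tm L) k Gs hGsm σ (by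
      intro G hG
      obtain ⟨v, hv, rfl⟩ := (hGsm G).1 hG
      have h1 : 2 * L - e ≤ s (k v) := S.g_lo (j := j) v hv
      have h2 : s (k v) ≤ 91 * L := S.g_up hj _
      simp only [hσ]
      split_ifs <;> constructor <;> linarith)
    (by
      intro u v hu hv huv
      simp only [hσ]
      split_ifs with hG
      · exact hshort _ hG u v hu hv rfl huv.symm
      · obtain ⟨c, hc, w⟩ := S.g_walk hu hv huv
        exact ⟨c, hc, HJ.toEJ w⟩)
    star (fun v => (S.kstar v).1) (fun v hv => (S.st1 v hv).1)
    (fun v => ⟨_, by linarith [S.cl4 v], HJ.toEJ (S.kstar v).2.1⟩) S.kconn I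
    ((Finset.filter_subset _ _).trans hGBGs) (fun G => star (aa G))
    (by
      intro G hG
      obtain ⟨hG1, hG2⟩ := Finset.mem_filter.1 hG
      refine ⟨(S.kstar _).1, hG2, ?_⟩
      intro u hu huG
      obtain ⟨c1, c2, c3⟩ := hch G hG1
      obtain ⟨-, kb, b1, b2, b3⟩ := hBm _ c1
      obtain ⟨l0, l4, lw⟩ := hact _ _ _ c3
      obtain ⟨ks, ws, cs, -⟩ := S.kstar (aa G)
      obtain ⟨c, hc, w⟩ := S.g_int kb hu (huG.trans c2.symm) b1 b2 b3
      have hσG : σ G = s G := by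
        simp only [hσ]
        rw [if_neg]
        intro hh
        exact hG2 (Finset.mem_filter.1 hh).2.1
      refine ⟨_, ?_, (HJ.toEJ w).app (Or.inr c3) (HJ.toEJ ws)⟩
      rw [hσG]
      have hc' : c ≤ s G - 9 * L := by rw [← c2]; exact hc
      linarith [S.cl4 (aa G)])
  refine ⟨N', iN, Adj', ω', π', m1, m2, m3, m4, ?_⟩
  -- accounting
  have a1 : ∑ G ∈ Gs, s G = ∑ w ∈ Finset.univ.filter (Kp d h Tm L), ω w := by
    rw [← Finset.sum_fiberwise_of_maps_to (s := Finset.univ.filter (Kp d h Tm L)) (t := Gs) (g := k)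
      (fun w hw => Finset.mem_image_of_mem _ hw) ω]
    apply Finset.sum_congr rfl
    intro G _
    simp only [hs, sG, Finset.filter_filter, hk]
  have a2 : ∑ G ∈ Gs, σ G = ∑ G ∈ Gs, s G - e * IIb.card := by
    have : ∀ G ∈ Gs, σ G = s G - if G ∈ IIb then e else 0 := by
      intro G _
      simp only [hσ]
      split_ifs <;> ring
    rw [Finset.sum_congr rfl this, Finset.sum_sub_distrib, Finset.sum_ite_mem,
      Finset.inter_eq_right.2 ((Finset.filter_subset _ _).trans hGBGs), Finset.sum_const,
      nsmul_eq_mul, mul_comm]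
  have a3 : ∑ w ∈ Finset.univ.filter (Kp d h Tm L), ω w + ∑ w ∈ Dd, ω w = ∑ w, ω w :=
    Finset.sum_filter_add_sum_filter_not _ _ _
  have a4 : lo * Dd.card ≤ ∑ w ∈ Dd, ω w := S.card_le Dd
  have a5 : lo * En.card ≤ 11 * ∑ w ∈ Dd, ω w := (S.card_le En).trans S.end_le
  have a6 : lo * B.card ≤ 91 * L * GB.card := by
    refine (S.card_le B).trans ?_
    rw [← Finset.sum_fiberwise_of_maps_to (s := B) (t := GB) (g := k)
      (fun w hw => Finset.mem_image_of_mem _ hw) ω]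
    have : ∀ G ∈ GB, ∑ w ∈ B.filter (fun w => k w = G), ω w ≤ 91 * L := by
      intro G _
      refine le_trans ?_ (S.g_up hj G)
      unfold sG
      apply Finset.sum_le_sum_of_subset_of_nonneg
      · intro w hw
        obtain ⟨w1, w2⟩ := Finset.mem_filter.1 hw
        simp only [Finset.mem_filter, Finset.mem_univ, true_and]
        exact ⟨(hBm w w1).2.1, w2⟩
      · intro w _ _
        exact (S.pos w).le
    refine (Finset.sum_le_card_nsmul _ _ _ this).trans ?_
    rw [nsmul_eq_mul]
    linarith
  have a7 : 2 * e * IIa.card ≤ ∑ w ∈ Dd, ω w := by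
    refine le_trans ?_ (fib_le Dd IIa (fun w => k (star w)) ω (fun w _ => (S.pos w).le))
    have : ∀ G ∈ IIa, 2 * e ≤ ∑ w ∈ Dd.filter (fun w => k (star w) = G), ω w := by
      intro G hG
      obtain ⟨hG1, hG2, hG3⟩ := Finset.mem_filter.1 hG
      refine hG3.trans ((S.clsum (aa G)).trans ?_)
      apply Finset.sum_le_sum_of_subset_of_nonneg
      · intro w hw
        simp only [hDd, Finset.mem_filter, Finset.mem_univ, true_and] at hw ⊢
        exact ⟨hw.1, by rw [hw.2, hG2]⟩
      · intro w _ _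
        exact (S.pos w).le
    refine le_trans ?_ (Finset.card_nsmul_le_sum _ _ _ this)
    rw [nsmul_eq_mul]
    linarith
  have a8 : (GB.card : ℝ) ≤ I.card + IIa.card + IIb.card := by
    have hsub : GB ⊆ I ∪ (IIa ∪ IIb) := by
      intro G hG
      simp only [hI, hIIa, hIIb, Finset.mem_union, Finset.mem_filter]
      rcases le_or_gt (2 * e) (cl (aa G)) with h1 | h1 <;> tauto
    have h1 := Finset.card_le_card hsub
    have h2 := Finset.card_union_le I (IIa ∪ IIb)
    have h3 := Finset.card_union_le IIa IIb
    have : GB.card ≤ I.card + IIa.card + IIb.card := by omega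
    exact_mod_cast this
  have a9 : (Ac.card : ℝ) ≤ Dd.card + En.card + NE.card := by
    have hsub : Ac ⊆ Dd ∪ (En ∪ NE) := by
      intro w hw
      simp only [hAc, hDd, hEn, hNE, Finset.mem_union, Finset.mem_filter, Finset.mem_univ,
        true_and] at hw ⊢
      by_cases hk : Kp d h Tm L w
      · rcases lt_or_ge (h w) (12 * L) with h1 | h1
        · tauto
        rcases lt_or_ge (Tm (d w)) (h w + 10 * L) with h2 | h2 <;> tauto
      · exact Or.inl hk
    have h1 := Finset.card_le_card hsub
    have h2 := Finset.card_union_le Dd (En ∪ NE)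
    have h3 := Finset.card_union_le En NE
    have : Ac.card ≤ Dd.card + En.card + NE.card := by omega
    exact_mod_cast this
  have a10 : (NE.card : ℝ) ≤ 3 * B.card := by exact_mod_cast hcard
  have lo0 := S.lo0
  have hD0 : 0 ≤ ∑ w ∈ Dd, ω w := Finset.sum_nonneg fun w _ => (S.pos w).le
  have fin := step_arith lo e L (∑ w ∈ Dd, ω w) I.card IIa.card IIb.card Dd.card En.card NE.card
    B.card GB.card Ac.card lo0 he0 hL heL hD0 (Nat.cast_nonneg _) (Nat.cast_nonneg _)
    a4 a5 a6 a7 a8 a9 a10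
  linarith
end SClemmas2


open Classical in
theorem comb_step {N : Type} [Fintype N] [Nonempty N] (Adj : N → N → Prop)
    (hA : ∀ u v, Adj u v → Adj v u) (hc : ∀ u v, Relation.ReflTransGen Adj u v) (ω : N → ℝ)
    (lo e L : ℝ) (lo0 : 0 < lo) (hlo : ∀ v, lo ≤ ω v) (he : ∀ v, ω v ≤ e) (eL : 100 * e ≤ L)
    (act : N → N → ℝ → Prop) (hsym : ∀ u v l, act u v l → act v u l)
    (hact : ∀ a b l, act a b l → 0 ≤ l ∧ l ≤ 4 * L ∧ ∀ c, Wk (HJ Adj) ω a b c → l + 40 * e ≤ c) :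
    ∃ (N' : Type) (_ : Fintype N') (Adj' : N' → N' → Prop) (ω' : N' → ℝ) (π' : N → N'),
      (∀ u v, Adj' u v → Adj' v u) ∧ (∀ u v, Relation.ReflTransGen Adj' u v) ∧
      (∀ u, 0 ≤ ω' u ∧ ω' u ≤ 3 * (91 * L)) ∧ ((∀ u, L ≤ ω' u) ∨ Subsingleton N') ∧
      (∀ u v c', Wk (HJ Adj') ω' (π' u) (π' v) c' →
        ∃ c ≤ c' + 8 * L, Wk (EJ Adj act) ω u v c) ∧
      ∑ u, ω' u + lo * e / (1000 * L) * (Finset.univ.filter (fun a => ∃ b l, act a b l)).card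
        ≤ ∑ u, ω u := by
  obtain ⟨o⟩ := ‹Nonempty N›
  have hpos : ∀ v, 0 < ω v := fun v => lo0.trans_le (hlo v)
  have he0 : 0 < e := (hpos o).trans_le (he o)
  have hL : 0 < L := by linarith
  obtain ⟨par, rk, d, h, P⟩ := exists_LPD Adj hA hc ω hpos o
  by_cases hroot : 4 * L ≤ h o + ω o
  · have hTm : ∀ x, ∃ M : ℝ, (∀ w, d w = x → h w + ω w ≤ M) ∧
        ((∃ w, d w = x) → ∃ w, d w = x ∧ M = h w + ω w) := by
      intro x
      by_cases hx : ∃ w, d w = x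
      · obtain ⟨w, hw⟩ := hx
        obtain ⟨t, ht, ht'⟩ := Finset.exists_max_image (Finset.univ.filter (fun w => d w = x))
          (fun w => h w + ω w) ⟨w, by simp [hw]⟩
        simp only [Finset.mem_filter, Finset.mem_univ, true_and] at ht ht'
        exact ⟨h t + ω t, ht', fun _ => ⟨t, ht, rfl⟩⟩
      · exact ⟨0, fun w hw => absurd ⟨w, hw⟩ hx, fun h => absurd h hx⟩
    choose Tm hT1 hT2 using hTm
    obtain ⟨F, hF0, hF⟩ := exists_rec o par rk P.rkl ((o, 0) : N × ℝ)
      (fun v a => if Kp d h Tm L v then (v, 0) else (a.1, ω v + a.2))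
    have hko : Kp d h Tm L o :=
      ⟨by linarith [he o], hroot.trans (hT1 (d o) o rfl)⟩
    have S : SC Adj ω o par rk d h Tm (fun v => (F v).1) (fun v => (F v).2) lo e L := by
      refine ⟨P, hA, lo0, hlo, he, eL, fun w => hT1 _ w rfl, fun v => hT2 _ ⟨v, rfl⟩, hroot, ?_, ?_⟩
      · intro v hv
        by_cases hvo : v = o
        · simp [hvo, hF0]
        · simp [hF v hvo, hv]
      · intro v hv
        have hvo : v ≠ o := fun h => hv (h ▸ hko)
        refine ⟨hvo, ?_, ?_⟩ <;> simp [hF v hvo, hv]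
    obtain ⟨N', iN, Adj', ω', π', m1, m2, m3, m4, m5⟩ := S.step act hsym hact
    exact ⟨N', iN, Adj', ω', π', m1, m2, fun u => ⟨hL.le.trans (m3 u).1, (m3 u).2⟩,
      Or.inl fun u => (m3 u).1, m4, m5⟩
  · push Not at hroot
    have key : ∀ n v, rk v = n → ∃ c, Wk (HJ Adj) ω v o c ∧ h v + c ≤ h o + ω o := by
      intro n
      induction n using Nat.strong_induction_on with
      | _ n ih =>
      intro v hn
      by_cases hvo : v = o
      · rw [hvo]
        exact ⟨_, Wk.nil o, le_rfl⟩
      · obtain ⟨c, w, hcc⟩ := ih _ (hn ▸ P.rkl v hvo) (par v) rfl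
        exact ⟨_, Wk.cons ⟨P.adj v hvo, rfl⟩ w, by linarith [P.h2 v hvo]⟩
    refine ⟨Unit, inferInstance, fun _ _ => False, fun _ => 0, fun _ => (), ?_, ?_, ?_, ?_, ?_, ?_⟩
    · intro _ _ h; exact h
    · intro _ _; exact Relation.ReflTransGen.refl
    · intro _
      exact ⟨le_rfl, by positivity⟩
    · exact Or.inr inferInstance
    · intro u v c' hw
      have hc' : c' = 0 := by
        cases hw with
        | nil => rfl
        | cons hl _ => exact hl.1.elim
      obtain ⟨c1, w1, k1⟩ := key _ u rfl
      obtain ⟨c2, w2, k2⟩ := key _ v rfl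
      refine ⟨_, ?_, HJ.toEJ (w1.concat (w2.symm (HJ.symm hA)))⟩
      linarith [P.h0 u, P.h0 v, hpos o]
    · simp only [Finset.sum_const_zero, zero_add]
      have h1 := Finset.card_nsmul_le_sum (Finset.univ.filter (fun a => ∃ b l, act a b l)) ω lo
        (fun w _ => hlo w)
      rw [nsmul_eq_mul] at h1
      have h2 : ∑ w ∈ Finset.univ.filter (fun a => ∃ b l, act a b l), ω w ≤ ∑ w, ω w :=
        Finset.sum_le_sum_of_subset_of_nonneg (Finset.subset_univ _) fun w _ _ => (hpos w).le
      refine le_trans ?_ (h1.trans h2)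
      have h3 : lo * e / (1000 * L) ≤ lo := by
        rw [div_le_iff₀ (by positivity)]
        nlinarith
      rw [mul_comm (_ : ℝ) lo]
      gcongr


section metricLemmas
variable {X : Type u} [MetricSpace X]

theorem sym2Dist_mk (x y : X) : sym2Dist s(x, y) = dist x y := rfl

theorem sym2Dist_nonneg (e : Sym2 X) : 0 ≤ sym2Dist e := by
  induction e with
  | _ x y => exact dist_nonneg

theorem edgeWeight_nonneg (E : Finset (Sym2 X)) : 0 ≤ edgeWeight E :=
  Finset.sum_nonneg fun e _ => sym2Dist_nonneg e

theorem edgeWeight_mono {E F : Finset (Sym2 X)} (h : E ⊆ F) : edgeWeight E ≤ edgeWeight F :=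
  Finset.sum_le_sum_of_subset_of_nonneg h fun e _ _ => sym2Dist_nonneg e

theorem edgeWeight_union [DecidableEq (Sym2 X)] (E F : Finset (Sym2 X)) :
    edgeWeight (E ∪ F) ≤ edgeWeight E + edgeWeight F := by
  unfold edgeWeight
  have h1 := Finset.sum_union_inter (f := sym2Dist) (s₁ := E) (s₂ := F)
  have h2 : 0 ≤ ∑ e ∈ E ∩ F, sym2Dist e := Finset.sum_nonneg fun e _ => sym2Dist_nonneg e
  linarith

theorem pathLength_nonneg (p : X) (l : List X) : 0 ≤ pathLength p l := by
  induction l generalizing p with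
  | nil => exact le_rfl
  | cons x xs ih => exact add_nonneg dist_nonneg (ih x)

theorem isPathIn_nil {E : Finset (Sym2 X)} {p q : X} : IsPathIn E p q [] ↔ p = q := by
  unfold IsPathIn List.Chain
  simp

theorem isPathIn_cons {E : Finset (Sym2 X)} {p q x : X} {l : List X} :
    IsPathIn E p q (x :: l) ↔ s(p, x) ∈ E ∧ IsPathIn E x q l := by
  unfold IsPathIn List.Chain
  rw [List.isChain_cons_cons, List.getLast_cons (List.cons_ne_nil x l)]
  tauto

theorem pathDist_le {E : Finset (Sym2 X)} {p q : X} {l : List X} (h : IsPathIn E p q l) :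
    pathDist E p q ≤ ENNReal.ofReal (pathLength p l) :=
  iInf₂_le l h

theorem pathDist_self (E : Finset (Sym2 X)) (p : X) : pathDist E p p = 0 := by
  have := pathDist_le (E := E) (isPathIn_nil.2 (rfl : p = p))
  simpa [pathLength] using this

theorem pathDist_cons {E : Finset (Sym2 X)} {p x : X} (h : s(p, x) ∈ E) (q : X) :
    pathDist E p q ≤ ENNReal.ofReal (dist p x) + pathDist E x q := by
  conv_rhs => unfold pathDist
  rw [ENNReal.add_iInf]
  refine le_iInf fun l => ?_
  rw [ENNReal.add_iInf]
  refine le_iInf fun hl => ?_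
  rw [← ENNReal.ofReal_add dist_nonneg (pathLength_nonneg _ _)]
  exact pathDist_le (isPathIn_cons.2 ⟨h, hl⟩)

theorem pathDist_edge {E : Finset (Sym2 X)} {p x : X} (h : s(p, x) ∈ E) :
    pathDist E p x ≤ ENNReal.ofReal (dist p x) := by
  have := pathDist_cons h x
  rwa [pathDist_self, add_zero] at this

theorem pathDist_path {E : Finset (Sym2 X)} {p q : X} {l : List X} (h : IsPathIn E p q l) (z : X) :
    pathDist E p z ≤ ENNReal.ofReal (pathLength p l) + pathDist E q z := by
  induction l generalizing p with
  | nil =>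
    rw [isPathIn_nil.1 h]
    exact le_add_self
  | cons x xs ih =>
    obtain ⟨h1, h2⟩ := isPathIn_cons.1 h
    refine (pathDist_cons h1 z).trans ?_
    rw [pathLength, ENNReal.ofReal_add dist_nonneg (pathLength_nonneg _ _), add_assoc]
    gcongr
    exact ih h2

theorem pathDist_triangle (E : Finset (Sym2 X)) (p q z : X) :
    pathDist E p z ≤ pathDist E p q + pathDist E q z := by
  conv_rhs => enter [1]; unfold pathDist
  rw [ENNReal.iInf_add]
  refine le_iInf fun l => ?_
  rw [ENNReal.iInf_add]
  exact le_iInf fun hl => pathDist_path hl z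

theorem pathDist_comm_le (E : Finset (Sym2 X)) (p q : X) : pathDist E q p ≤ pathDist E p q := by
  have key : ∀ (l : List X) (p : X), IsPathIn E p q l →
      pathDist E q p ≤ ENNReal.ofReal (pathLength p l) := by
    intro l
    induction l with
    | nil =>
      intro p h
      rw [isPathIn_nil.1 h, pathDist_self]
      exact zero_le
    | cons x xs ih =>
      intro p h
      obtain ⟨h1, h2⟩ := isPathIn_cons.1 h
      refine (pathDist_triangle E q x p).trans ?_
      rw [pathLength, ENNReal.ofReal_add dist_nonneg (pathLength_nonneg _ _), add_comm]
      gcongr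
      · rw [dist_comm]
        exact pathDist_edge (by rwa [Sym2.eq_swap])
      · exact ih x h2
  exact le_iInf₂ fun l hl => key l p hl

theorem pathDist_mono {E F : Finset (Sym2 X)} (h : E ⊆ F) (p q : X) :
    pathDist F p q ≤ pathDist E p q :=
  le_iInf₂ fun _ hl => pathDist_le ⟨List.IsChain.imp (fun _ _ hab => h hab) hl.1, hl.2⟩

theorem dist_le_pathDist (E : Finset (Sym2 X)) (p q : X) :
    ENNReal.ofReal (dist p q) ≤ pathDist E p q := by
  have key : ∀ (l : List X) (p : X), IsPathIn E p q l → dist p q ≤ pathLength p l := by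
    intro l
    induction l with
    | nil =>
      intro p h
      rw [isPathIn_nil.1 h, dist_self]
      exact le_rfl
    | cons x xs ih =>
      intro p h
      obtain ⟨h1, h2⟩ := isPathIn_cons.1 h
      exact (dist_triangle p x q).trans (by simpa [pathLength] using ih x h2)
  exact le_iInf₂ fun l hl => ENNReal.ofReal_le_ofReal (key l p hl)

/-- Path distance at most a real number. -/
def PD (E : Finset (Sym2 X)) (x y : X) (c : ℝ) : Prop := pathDist E x y ≤ ENNReal.ofReal c

theorem PD.le_mono {E : Finset (Sym2 X)} {x y : X} {c c' : ℝ} (h : PD E x y c) (hc : c ≤ c') :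
    PD E x y c' := le_trans h (ENNReal.ofReal_le_ofReal hc)

theorem PD.sub {E F : Finset (Sym2 X)} {x y : X} {c : ℝ} (h : PD E x y c) (hc : E ⊆ F) :
    PD F x y c := (pathDist_mono hc x y).trans h

theorem PD.refl (E : Finset (Sym2 X)) (x : X) {c : ℝ} : PD E x x c := by
  unfold PD
  rw [pathDist_self]
  exact zero_le

theorem PD.symm {E : Finset (Sym2 X)} {x y : X} {c : ℝ} (h : PD E x y c) : PD E y x c :=
  (pathDist_comm_le E x y).trans h

theorem PD.trans {E : Finset (Sym2 X)} {x y z : X} {c c' : ℝ} (h : PD E x y c) (h' : PD E y z c')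
    (hc : 0 ≤ c) (hc' : 0 ≤ c') : PD E x z (c + c') := by
  unfold PD
  rw [ENNReal.ofReal_add hc hc']
  exact (pathDist_triangle E x y z).trans (add_le_add h h')

theorem PD.dist_le {E : Finset (Sym2 X)} {x y : X} {c : ℝ} (h : PD E x y c) (hc : 0 ≤ c) :
    dist x y ≤ c := by
  have := (dist_le_pathDist E x y).trans h
  exact (ENNReal.ofReal_le_ofReal_iff hc).1 this

theorem exists_crossing {E : Finset (Sym2 X)} (V : Set X) {q : X} (hq : q ∉ V) :
    ∀ (l : List X) (p : X), p ∈ V → IsPathIn E p q l → ∃ v w, v ∈ V ∧ w ∉ V ∧ s(v, w) ∈ E := by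
  intro l
  induction l with
  | nil =>
    intro p hp h
    exact absurd (isPathIn_nil.1 h ▸ hp) hq
  | cons x xs ih =>
    intro p hp h
    obtain ⟨h1, h2⟩ := isPathIn_cons.1 h
    by_cases hx : x ∈ V
    · exact ih x hx h2
    · exact ⟨p, x, hp, hx, h1⟩

theorem tour {T : Finset X} {E : Finset (Sym2 X)} (hE : IsEdgeSetOn T E)
    (hc : ∀ x ∈ T, ∀ y ∈ T, pathDist E x y < ⊤) (hT : T.Nonempty) :
    ∃ p : X → ℝ, (∀ x ∈ T, 0 ≤ p x ∧ p x ≤ 2 * edgeWeight E) ∧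
      ∀ x ∈ T, ∀ y ∈ T, PD E x y |p x - p y| := by
  classical
  have key : ∀ (n : ℕ) (V : Finset X) (F : Finset (Sym2 X)) (p : X → ℝ), (T \ V).card = n →
      V ⊆ T → V.Nonempty → F ⊆ E → (∀ e ∈ F, ∀ x ∈ e, x ∈ V) →
      (∀ x ∈ V, 0 ≤ p x ∧ p x ≤ 2 * edgeWeight F) →
      (∀ x ∈ V, ∀ y ∈ V, PD E x y |p x - p y|) →
      ∃ p : X → ℝ, (∀ x ∈ T, 0 ≤ p x ∧ p x ≤ 2 * edgeWeight E) ∧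
      ∀ x ∈ T, ∀ y ∈ T, PD E x y |p x - p y| := by
    intro n
    induction n with
    | zero =>
      intro V F p hn hVT _ hF _ h1 h2
      have : T ⊆ V := Finset.sdiff_eq_empty_iff_subset.1 (Finset.card_eq_zero.1 hn)
      refine ⟨p, fun x hx => ⟨(h1 x (this hx)).1, ?_⟩, fun x hx y hy => h2 x (this hx) y (this hy)⟩
      linarith [(h1 x (this hx)).2, edgeWeight_mono hF]
    | succ n ih =>
      intro V F p hn hVT hV hF hFV h1 h2
      obtain ⟨y, hy⟩ : (T \ V).Nonempty := Finset.card_pos.1 (by omega)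
      obtain ⟨hyT, hyV⟩ := Finset.mem_sdiff.1 hy
      obtain ⟨x, hx⟩ := hV
      have hlt := hc x (hVT hx) y hyT
      unfold pathDist at hlt
      simp only [iInf_lt_iff] at hlt
      obtain ⟨l, hl, -⟩ := hlt
      obtain ⟨v, w, hv, hw, hvw⟩ := exists_crossing (V : Set X) (by simpa using hyV) l x
        (by simpa using hx) hl
      simp only [Finset.mem_coe] at hv hw
      have hwT : w ∈ T := (hE _ hvw).2 w (by simp)
      have hd : 0 ≤ dist v w := dist_nonneg
      have hnF : s(v, w) ∉ F := fun h => hw (hFV _ h w (by simp))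
      have hwt : edgeWeight (insert s(v, w) F) = dist v w + edgeWeight F := by
        unfold edgeWeight
        rw [Finset.sum_insert hnF, sym2Dist_mk]
      have hxw : ∀ x ∈ V, x ≠ w := fun x hx h => hw (h ▸ hx)
      have hpw : ∀ x ∈ V, PD E x w |(if p x ≤ p v then p x else p x + 2 * dist v w) -
          (p v + dist v w)| := by
        intro x hx
        have h3 : PD E x w (|p x - p v| + dist v w) :=
          (h2 x hx v hv).trans (pathDist_edge hvw) (abs_nonneg _) hd
        refine h3.le_mono ?_
        split_ifs with h
        · rw [abs_of_nonpos (by linarith : p x - p v ≤ 0)]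
          exact le_trans (by linarith) (neg_le_abs _)
        · rw [abs_of_nonneg (by linarith : 0 ≤ p x - p v)]
          exact le_trans (by linarith) (le_abs_self _)
      refine ih (insert w V) (insert s(v, w) F)
        (fun x => if x = w then p v + dist v w else if p x ≤ p v then p x else p x + 2 * dist v w)
        ?_ ?_ ?_ ?_ ?_ ?_ ?_
      · have : T \ insert w V = (T \ V).erase w := by
          ext z
          simp only [Finset.mem_sdiff, Finset.mem_insert, Finset.mem_erase]
          tauto
        rw [this, Finset.card_erase_of_mem (Finset.mem_sdiff.2 ⟨hwT, hw⟩), hn]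
        rfl
      · exact Finset.insert_subset hwT hVT
      · exact ⟨w, by simp⟩
      · exact Finset.insert_subset hvw hF
      · intro e he z hz
        rcases Finset.mem_insert.1 he with rfl | he
        · rcases Sym2.mem_iff.1 hz with rfl | rfl
          · simp [hv]
          · simp
        · exact Finset.mem_insert_of_mem (hFV e he z hz)
      · intro z hz
        rw [hwt]
        rcases Finset.mem_insert.1 hz with rfl | hz
        · simp only [if_true]
          constructor <;> linarith [(h1 v hv).1, (h1 v hv).2]
        · simp only [if_neg (hxw z hz)]
          split_ifs <;> constructor <;> linarith [(h1 z hz).1, (h1 z hz).2]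
      · intro a ha b hb
        rcases Finset.mem_insert.1 ha with hae | ha1 <;>
          rcases Finset.mem_insert.1 hb with hbe | hb1
        · rw [hae, hbe]
          exact PD.refl _ _
        · rw [hae]
          simp only [if_true, if_neg (hxw b hb1)]
          rw [abs_sub_comm]
          exact (hpw b hb1).symm
        · rw [hbe]
          simp only [if_true, if_neg (hxw a ha1)]
          exact hpw a ha1
        · simp only [if_neg (hxw a ha1), if_neg (hxw b hb1)]
          refine (h2 a ha1 b hb1).le_mono ?_
          rw [abs_le]
          split_ifs with hA hB hB
          · exact ⟨neg_abs_le _, le_abs_self _⟩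
          · constructor <;> linarith [neg_abs_le (p a - (p b + 2 * dist v w)),
              abs_nonneg (p a - (p b + 2 * dist v w))]
          · constructor <;> linarith [le_abs_self (p a + 2 * dist v w - p b),
              abs_nonneg (p a + 2 * dist v w - p b)]
          · have hq : p a + 2 * dist v w - (p b + 2 * dist v w) = p a - p b := by ring
            rw [hq]
            exact ⟨neg_abs_le _, le_abs_self _⟩
  obtain ⟨x0, hx0⟩ := hT
  refine key _ {x0} ∅ (fun _ => 0) rfl (by simpa using hx0) (by simp) (by simp) (by simp) ?_ ?_
  · intro x _
    simp [edgeWeight]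
  · intro x hx y hy
    simp only [Finset.mem_singleton] at hx hy
    rw [hx, hy]
    exact PD.refl _ _

theorem mst_exists {T : Finset X} :
    ∃ E : Finset (Sym2 X), IsEdgeSetOn T E ∧ (∀ x ∈ T, ∀ y ∈ T, pathDist E x y < ⊤) ∧
      mstw T = edgeWeight E := by
  classical
  have hmem : mstw T ∈ {w : ℝ | ∃ E : Finset (Sym2 X), IsEdgeSetOn T E ∧
    (∀ x ∈ T, ∀ y ∈ T, pathDist E x y < ⊤) ∧ w = edgeWeight E} := by
    apply Set.Nonempty.csInf_mem
    · refine ⟨_, T.sym2.filter (fun e => ¬ e.IsDiag), ?_, ?_, rfl⟩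
      · intro e he
        obtain ⟨h1, h2⟩ := Finset.mem_filter.1 he
        exact ⟨h2, fun x hx => Finset.mem_sym2_iff.1 h1 x hx⟩
      · intro x hx y hy
        by_cases hxy : x = y
        · rw [hxy, pathDist_self]
          exact ENNReal.zero_lt_top
        · refine (pathDist_edge ?_).trans_lt ENNReal.ofReal_lt_top
          rw [Finset.mem_filter, Finset.mk_mem_sym2_iff]
          exact ⟨⟨hx, hy⟩, by simpa using hxy⟩
    · refine ((T.sym2.powerset.finite_toSet).image edgeWeight).subset ?_
      rintro w ⟨E, hE, -, rfl⟩
      refine ⟨E, ?_, rfl⟩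
      simp only [Finset.coe_powerset, Set.mem_preimage, Set.mem_powerset_iff, Finset.coe_subset]
      intro e he
      exact Finset.mem_sym2_iff.2 fun x hx => (hE e he).2 x hx
  exact hmem

end metricLemmas


section stateLemmas
variable {X : Type u} [MetricSpace X]

/-- The state of the construction at a level. -/
def St (T : Finset X) (S : Finset (Sym2 X)) (e r lo Φ : ℝ) : Prop :=
  ∃ (N : Type) (_ : Fintype N) (Adj : N → N → Prop) (ω : N → ℝ) (π : X → N),
    (∀ u v, Adj u v → Adj v u) ∧ (∀ u v, Relation.ReflTransGen Adj u v) ∧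
    (∀ u, 0 ≤ ω u ∧ ω u ≤ e) ∧ ((∀ u, lo ≤ ω u) ∨ Subsingleton N) ∧
    ∑ u, ω u ≤ Φ ∧
    ∀ x ∈ T, ∀ y ∈ T, ∀ c, Wk (HJ Adj) ω (π x) (π y) c → PD S x y (2 * r + c)

theorem line_walk {n : ℕ} {w : ℝ} (hw : 0 ≤ w) {i j : Fin n} {c : ℝ}
    (h : Wk (HJ (fun a b : Fin n => a.1 + 1 = b.1 ∨ b.1 + 1 = a.1)) (fun _ => w) i j c) :
    (|((i.1 : ℝ) - j.1)| + 1) * w ≤ c := by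
  induction h with
  | nil u => simp
  | @cons u v z l c hl _ ih =>
    obtain ⟨h1, rfl⟩ := hl
    have h2 : |((u.1 : ℝ) - z.1)| ≤ |((v.1 : ℝ) - z.1)| + 1 := by
      have h3 : |((u.1 : ℝ) - v.1)| = 1 := by
        rcases h1 with h | h
        · rw [← h]; push_cast; simp
        · rw [← h]; push_cast; simp
      calc |((u.1 : ℝ) - z.1)| = |((v.1 : ℝ) - z.1) + (u.1 - v.1)| := by ring_nf
        _ ≤ _ := (abs_add_le _ _).trans (by rw [h3])
    nlinarith

theorem line_conn {n : ℕ} (i j : Fin n) :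
    Relation.ReflTransGen (fun a b : Fin n => a.1 + 1 = b.1 ∨ b.1 + 1 = a.1) i j := by
  have key : ∀ (k : ℕ) (i j : Fin n), i.1 + k = j.1 →
      Relation.ReflTransGen (fun a b : Fin n => a.1 + 1 = b.1 ∨ b.1 + 1 = a.1) i j := by
    intro k
    induction k with
    | zero =>
      intro i j h
      rw [Fin.ext (by simpa using h : i.1 = j.1)]
    | succ k ih =>
      intro i j h
      exact Relation.ReflTransGen.head (b := ⟨i.1 + 1, by omega⟩) (Or.inl rfl)
        (ih _ _ (by simp only; omega))
  rcases le_total i.1 j.1 with h | h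
  · exact key (j.1 - i.1) i j (by omega)
  · have hk := key (i.1 - j.1) j i (by omega)
    haveI : Std.Symm (fun a b : Fin n => a.1 + 1 = b.1 ∨ b.1 + 1 = a.1) :=
      ⟨fun a b hab => hab.symm⟩
    exact Relation.ReflTransGen.stdSymm.symm _ _ hk

theorem init_state {T : Finset X} {E : Finset (Sym2 X)} (hE : IsEdgeSetOn T E)
    (hc : ∀ x ∈ T, ∀ y ∈ T, pathDist E x y < ⊤) (hT : T.Nonempty) (hM : 0 < edgeWeight E)
    (e : ℝ) (he : 0 < e) : St T E e 0 (e / 2) (2 * edgeWeight E) := by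
  obtain ⟨p, hp, hpd⟩ := tour hE hc hT
  set M := 2 * edgeWeight E with hMdef
  have hM0 : 0 < M := by linarith
  obtain ⟨n, hn⟩ : ∃ n, n = ⌈M / e⌉₊ := ⟨_, rfl⟩
  have hn0 : 0 < n := by
    rw [hn]
    exact Nat.ceil_pos.2 (by positivity)
  have hnR : (0 : ℝ) < n := by exact_mod_cast hn0
  have hle : M / e ≤ n := by
    rw [hn]
    exact Nat.le_ceil _
  have hw0 : 0 < M / n := by positivity
  refine ⟨Fin n, inferInstance, fun a b => a.1 + 1 = b.1 ∨ b.1 + 1 = a.1, fun _ => M / n,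
    fun x => ⟨min ⌊p x * n / M⌋₊ (n - 1), by omega⟩, ?_, line_conn, ?_, ?_, ?_, ?_⟩
  · intro u v h
    exact h.symm
  · intro _
    refine ⟨hw0.le, ?_⟩
    rw [div_le_iff₀ hnR]
    rw [div_le_iff₀ he] at hle
    linarith
  · by_cases h1 : n = 1
    · right
      rw [h1]
      infer_instance
    · left
      intro _
      have hlt : (n : ℝ) < M / e + 1 := by
        rw [hn]
        exact Nat.ceil_lt_add_one (by positivity)
      have h2 : (2 : ℝ) ≤ n := by exact_mod_cast (by omega : 2 ≤ n)
      rw [le_div_iff₀ hnR]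
      have h3 : (n : ℝ) * e < M + e := by
        have := mul_lt_mul_of_pos_right hlt he
        rwa [add_mul, div_mul_cancel₀ _ he.ne', one_mul] at this
      nlinarith
  · simp only [Finset.sum_const, Finset.card_univ, Fintype.card_fin, nsmul_eq_mul]
    rw [mul_div_cancel₀ _ hnR.ne']
  · have hpos : ∀ x ∈ T, ((min ⌊p x * n / M⌋₊ (n - 1) : ℕ) : ℝ) * (M / n) ≤ p x ∧
        p x ≤ (((min ⌊p x * n / M⌋₊ (n - 1) : ℕ) : ℝ) + 1) * (M / n) := by
      intro x hx
      obtain ⟨h0, h1⟩ := hp x hx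
      have hq : p x = (p x * n / M) * (M / n) := by field_simp
      have hq0 : 0 ≤ p x * n / M := by positivity
      have hqn : p x * n / M ≤ n := by
        rw [div_le_iff₀ hM0]
        nlinarith
      constructor
      · conv_rhs => rw [hq]
        refine mul_le_mul_of_nonneg_right ?_ hw0.le
        refine le_trans ?_ (Nat.floor_le hq0)
        exact_mod_cast min_le_left _ _
      · conv_lhs => rw [hq]
        refine mul_le_mul_of_nonneg_right ?_ hw0.le
        rcases le_total ⌊p x * n / M⌋₊ (n - 1) with h | h
        · rw [min_eq_left h]
          exact (Nat.lt_floor_add_one _).le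
        · rw [min_eq_right h]
          refine hqn.trans ?_
          exact_mod_cast (by omega : n ≤ n - 1 + 1)
    intro x hx y hy c hcw
    have h1 := line_walk hw0.le hcw
    refine (hpd x hx y hy).le_mono ?_
    refine le_trans ?_ (by linarith : c ≤ 2 * 0 + c)
    refine le_trans ?_ h1
    obtain ⟨a1, a2⟩ := hpos x hx
    obtain ⟨b1, b2⟩ := hpos y hy
    simp only
    set i := ((min ⌊p x * n / M⌋₊ (n - 1) : ℕ) : ℝ)
    set j := ((min ⌊p y * n / M⌋₊ (n - 1) : ℕ) : ℝ)
    have h3 := le_abs_self (i - j)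
    have h4 := neg_abs_le (i - j)
    rw [abs_le]
    constructor <;> nlinarith

theorem Wk.cost_nonneg {N : Type} {J : N → N → ℝ → Prop} {ω : N → ℝ} (h0 : ∀ u, 0 ≤ ω u)
    (hJ : ∀ u v l, J u v l → 0 ≤ l) {u v : N} {c : ℝ} (h : Wk J ω u v c) : ω u ≤ c := by
  induction h with
  | nil u => exact le_rfl
  | @cons u v z l c hl _ ih => linarith [hJ _ _ _ hl, h0 v]

/-- Soundness of extended walks. -/
theorem ext_sound {N : Type} {T : Finset X} {S S' : Finset (Sym2 X)} (hS : S ⊆ S')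
    {Adj : N → N → Prop} {ω : N → ℝ} {π : X → N} {act : N → N → ℝ → Prop} {r : ℝ} (hr : 0 ≤ r)
    (h0 : ∀ u, 0 ≤ ω u)
    (hs : ∀ x ∈ T, ∀ y ∈ T, ∀ c, Wk (HJ Adj) ω (π x) (π y) c → PD S x y (2 * r + c))
    (hact : ∀ a b l, act a b l → ∃ x ∈ T, ∃ y ∈ T, ∃ d, 0 ≤ d ∧ π x = a ∧ π y = b ∧
      l = d + 2 * r ∧ PD S' x y d)
    {u w : N} {c : ℝ} (h : Wk (EJ Adj act) ω u w c) :
    ∀ x ∈ T, ∀ y ∈ T, ∀ c0, Wk (HJ Adj) ω (π x) u c0 → π y = w →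
      PD S' x y (2 * r + (c0 + c - ω u)) := by
  have hHJ : ∀ u v l, HJ Adj u v l → 0 ≤ l := fun u v l h => h.2 ▸ le_rfl
  have hEJ : ∀ u v l, EJ Adj act u v l → 0 ≤ l := by
    rintro u v l (h | h)
    · exact h.2 ▸ le_rfl
    · obtain ⟨x, _, y, _, d, hd, _, _, rfl, _⟩ := hact _ _ _ h
      linarith
  induction h with
  | nil u =>
    intro x hx y hy c0 hc0 hyw
    subst hyw
    exact ((hs x hx y hy c0 hc0).sub hS).le_mono (by linarith)
  | @cons u v z l c hl hw ih =>
    intro x hx y hy c0 hc0 hyw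
    have hcost := hw.cost_nonneg h0 hEJ
    rcases hl with hl | hl
    · have h1 : Wk (HJ Adj) ω (π x) v (c0 + l + ω v) := hc0.app hl (Wk.nil v)
      exact (ih x hx y hy _ h1 hyw).le_mono (by linarith)
    · obtain ⟨x', hx', y', hy', d, hd, rfl, rfl, rfl, hp⟩ := hact _ _ _ hl
      have h1 := (hs x hx x' hx' c0 hc0).sub hS
      have h2 := ih y' hy' y hy _ (Wk.nil _) hyw
      have hc00 := hc0.cost_nonneg h0 hHJ
      have e1 : 0 ≤ 2 * r + c0 := by linarith [h0 (π x)]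
      have e2 : 0 ≤ 2 * r + (ω (π y') + c - ω (π y')) := by linarith [h0 (π y')]
      exact ((h1.trans hp e1 hd).trans h2 (by linarith) e2).le_mono (by linarith)

end stateLemmas


section levelStep
variable {X : Type u} [MetricSpace X]

/-- The spanner oracle hypothesis. -/
def Orc (T : Finset X) (ε W : ℝ) : Prop :=
  ∀ T' : Finset X, T' ⊆ T → T'.Nonempty → ∀ ℓ : ℝ, 0 < ℓ →
    ∃ E : Finset (Sym2 X), IsEdgeSetOn T' E ∧ edgeWeight E ≤ W * T'.card * ℓ ∧
      ∀ x ∈ T', ∀ y ∈ T', x ≠ y → ℓ / 8 ≤ dist x y → dist x y ≤ ℓ →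
        pathDist E x y ≤ ENNReal.ofReal ((1 + ε) * dist x y)

theorem level_step {T : Finset X} {ε W L r Φ : ℝ} (hT : T.Nonempty) (ε0 : 0 < ε) (ε1 : ε < 1)
    (hW : 0 < W) (hO : Orc T ε W) (hL : 0 < L) (hr : 0 ≤ r) (hre : r ≤ ε * L / 100)
    {S : Finset (Sym2 X)} (hS : IsEdgeSetOn T S)
    (hst : St T S (ε * L / 100) r (ε * L / 100 / 600) Φ) :
    ∃ (S' : Finset (Sym2 X)) (Φ' : ℝ), S ⊆ S' ∧ IsEdgeSetOn T S' ∧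
      edgeWeight S' + 12000000000 * W / ε ^ 2 * Φ' ≤
        edgeWeight S + 12000000000 * W / ε ^ 2 * Φ ∧
      (∀ x ∈ T, ∀ y ∈ T, L / 2 < dist x y → dist x y ≤ L →
        PD S' x y ((1 + 3 * ε) * dist x y)) ∧
      ∀ e' lo', 273 * L ≤ e' → lo' ≤ L → St T S' e' (r + 4 * L) lo' Φ' := by
  classical
  obtain ⟨N, iN, Adj, ω, π, hA, hconn, hω, hlo, hsum, hs⟩ := hst
  obtain ⟨e, he⟩ : ∃ e, e = ε * L / 100 := ⟨_, rfl⟩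
  rw [← he] at hre hω hlo
  have heL : ε * L = 100 * e := by linarith
  have e0 : 0 < e := by rw [he]; positivity
  have eL : 100 * e ≤ L := by nlinarith
  have hnear : ∀ x ∈ T, ∀ y ∈ T, π x = π y → PD S x y (3 * e) := by
    intro x hx y hy hxy
    have h1 : Wk (HJ Adj) ω (π x) (π y) (ω (π x)) := hxy ▸ Wk.nil (π x)
    exact (hs x hx y hy _ h1).le_mono (by linarith [(hω (π x)).2])
  by_cases hsub : Subsingleton N
  · refine ⟨S, Φ, Finset.Subset.refl _, hS, le_rfl, ?_, ?_⟩
    · intro x hx y hy h1 h2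
      refine (hnear x hx y hy (Subsingleton.elim _ _)).le_mono ?_
      nlinarith
    · intro e' lo' he' hlo'
      refine ⟨N, iN, Adj, ω, π, hA, hconn, ?_, Or.inr hsub, hsum, ?_⟩
      · intro u
        exact ⟨(hω u).1, by linarith [(hω u).2]⟩
      · intro x hx y hy c hc
        exact (hs x hx y hy c hc).le_mono (by linarith)
  have hlo1 : ∀ u, e / 600 ≤ ω u := hlo.resolve_right hsub
  obtain ⟨x0, hx0⟩ := hT
  haveI : Nonempty N := ⟨π x0⟩
  -- active pairs
  let P : X → X → Prop := fun x y => x ∈ T ∧ y ∈ T ∧ L / 2 < dist x y ∧ dist x y ≤ L ∧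
    ¬ PD S x y ((1 + 3 * ε) * dist x y)
  have hPs : ∀ x y, P x y → P y x := by
    rintro x y ⟨h1, h2, h3, h4, h5⟩
    refine ⟨h2, h1, by rwa [dist_comm], by rwa [dist_comm], fun h => h5 ?_⟩
    rw [dist_comm]
    exact h.symm
  let act : N → N → ℝ → Prop := fun a b l => ∃ x y, P x y ∧ π x = a ∧ π y = b ∧
    l = (1 + 2 * ε) * dist x y + 2 * r
  have hasym : ∀ u v l, act u v l → act v u l := by
    rintro u v l ⟨x, y, h1, h2, h3, h4⟩
    exact ⟨y, x, hPs _ _ h1, h3, h2, by rw [dist_comm]; exact h4⟩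
  have hact : ∀ a b l, act a b l →
      0 ≤ l ∧ l ≤ 4 * L ∧ ∀ c, Wk (HJ Adj) ω a b c → l + 40 * e ≤ c := by
    rintro a b l ⟨x, y, ⟨h1, h2, h3, h4, h5⟩, rfl, rfl, rfl⟩
    have hd : 0 < dist x y := by linarith
    refine ⟨by positivity, by nlinarith, fun c hc => ?_⟩
    by_contra hcon
    push Not at hcon
    refine h5 ((hs x h1 y h2 c hc).le_mono ?_)
    nlinarith
  obtain ⟨N', iN', Adj', ω', π', k1, k2, k3, k4, k5, k6⟩ :=
    comb_step Adj hA hconn ω (e / 600) e L (by positivity) hlo1 (fun v => (hω v).2) eL act hasym hact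
  -- new edges
  obtain ⟨A, hAdef⟩ : ∃ A : Finset N, A = Finset.univ.filter (fun a => ∃ b l, act a b l) := ⟨_, rfl⟩
  have hrep : ∀ a : N, ∃ x : X, x ∈ T ∧ (a ∈ A → π x = a) := by
    intro a
    by_cases ha : a ∈ A
    · rw [hAdef] at ha
      obtain ⟨b, l, x, y, h1, h2, _⟩ := (Finset.mem_filter.1 ha).2
      exact ⟨x, h1.1, fun _ => h2⟩
    · exact ⟨x0, hx0, fun h => absurd h ha⟩
  choose rep hrT hrπ using hrep
  have hE : ∃ E : Finset (Sym2 X), IsEdgeSetOn T E ∧ edgeWeight E ≤ W * A.card * (2 * L) ∧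
      ∀ x ∈ T, ∀ y ∈ T, π x ∈ A → π y ∈ A → L / 2 < dist x y → dist x y ≤ L →
        PD E (rep (π x)) (rep (π y)) ((1 + ε) * dist (rep (π x)) (rep (π y))) := by
    rcases A.eq_empty_or_nonempty with hA0 | hA0
    · refine ⟨∅, ?_, ?_, ?_⟩
      · intro e he
        simp at he
      · simp [edgeWeight, hA0]
      · intro x _ y _ h
        simp [hA0] at h
    · obtain ⟨E, h1, h2, h3⟩ := hO (A.image rep)
        (fun z hz => by
          obtain ⟨a, _, rfl⟩ := Finset.mem_image.1 hz
          exact hrT a) (hA0.image _) (2 * L) (by linarith)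
      refine ⟨E, ?_, ?_, ?_⟩
      · intro e he
        refine ⟨(h1 e he).1, fun x hx => ?_⟩
        obtain ⟨a, _, rfl⟩ := Finset.mem_image.1 ((h1 e he).2 x hx)
        exact hrT a
      · refine h2.trans ?_
        have : ((A.image rep).card : ℝ) ≤ A.card := by exact_mod_cast Finset.card_image_le
        gcongr
      · intro x hx y hy hxA hyA hd1 hd2
        have d1 := (hnear x hx _ (hrT (π x)) (hrπ _ hxA).symm).dist_le (by linarith)
        have d2 := (hnear y hy _ (hrT (π y)) (hrπ _ hyA).symm).dist_le (by linarith)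
        have t1 := dist_triangle4 x (rep (π x)) (rep (π y)) y
        have t2 := dist_triangle4 (rep (π x)) x y (rep (π y))
        rw [dist_comm (rep (π y)) y] at t1
        rw [dist_comm (rep (π x)) x] at t2
        refine h3 _ (Finset.mem_image_of_mem _ hxA) _ (Finset.mem_image_of_mem _ hyA) ?_ ?_ ?_
        · intro heq
          have hz : dist (rep (π x)) (rep (π y)) = 0 := by rw [heq, dist_self]
          linarith
        · linarith
        · linarith
  obtain ⟨E, hE1, hE2, hE3⟩ := hE
  have hSS : S ⊆ S ∪ E := Finset.subset_union_left
  have hES : E ⊆ S ∪ E := Finset.subset_union_right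
  have hnew : ∀ x y, P x y → PD (S ∪ E) x y ((1 + 2 * ε) * dist x y) := by
    intro x y hxy
    have hxA : π x ∈ A := by
      rw [hAdef]
      exact Finset.mem_filter.2 ⟨Finset.mem_univ _, _, _, x, y, hxy, rfl, rfl, rfl⟩
    have hyA : π y ∈ A := by
      rw [hAdef]
      exact Finset.mem_filter.2 ⟨Finset.mem_univ _, _, _, y, x, hPs _ _ hxy, rfl, rfl, rfl⟩
    obtain ⟨hx, hy, hd1, hd2, -⟩ := hxy
    have n1 := hnear x hx _ (hrT (π x)) (hrπ _ hxA).symm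
    have n2 := hnear y hy _ (hrT (π y)) (hrπ _ hyA).symm
    have d1 := n1.dist_le (by linarith)
    have d2 := n2.dist_le (by linarith)
    have t2 := dist_triangle4 (rep (π x)) x y (rep (π y))
    rw [dist_comm (rep (π x)) x] at t2
    have m := hE3 x hx y hy hxA hyA hd1 hd2
    have hpos : 0 ≤ (1 + ε) * dist (rep (π x)) (rep (π y)) := by positivity
    have h3e : 0 ≤ 3 * e := by linarith
    refine (((n1.sub hSS).trans (m.sub hES) h3e hpos).trans (n2.sub hSS).symm
      (by linarith) h3e).le_mono ?_
    have q1 : (1 + ε) * dist (rep (π x)) (rep (π y)) ≤ (1 + ε) * (dist x y + 6 * e) := by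
      refine mul_le_mul_of_nonneg_left (by linarith) (by linarith)
    have q2 : ε * (L / 2) ≤ ε * dist x y := mul_le_mul_of_nonneg_left hd1.le ε0.le
    nlinarith
  refine ⟨S ∪ E, ∑ u, ω' u, hSS, ?_, ?_, ?_, ?_⟩
  · intro f hf
    rcases Finset.mem_union.1 hf with h | h
    · exact hS f h
    · exact hE1 f h
  · have u1 := edgeWeight_union S E
    have u2 : edgeWeight E ≤ 12000000000 * W / ε ^ 2 * (e / 600 * e / (1000 * L) * A.card) := by
      refine hE2.trans (le_of_eq ?_)
      have v1 : e / 600 * e / (1000 * L) = ε ^ 2 * (L / 6000000000) := by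
        rw [he, div_eq_iff (by positivity)]
        ring
      have v2 : 12000000000 * W / ε ^ 2 * (ε ^ 2 * (L / 6000000000) * A.card) =
          (12000000000 * W / ε ^ 2 * ε ^ 2) * (L / 6000000000) * A.card := by ring
      rw [v1, v2, div_mul_cancel₀ _ (by positivity)]
      ring
    have u3 : 0 < 12000000000 * W / ε ^ 2 := by positivity
    have u4 : ∑ u, ω' u + e / 600 * e / (1000 * L) * A.card ≤ Φ := by
      refine le_trans ?_ hsum
      refine le_trans (le_of_eq ?_) k6
      rw [hAdef]
    have u5 := mul_le_mul_of_nonneg_left u4 u3.le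
    rw [mul_add] at u5
    linarith
  · intro x hx y hy hd1 hd2
    by_cases hp : PD S x y ((1 + 3 * ε) * dist x y)
    · exact hp.sub hSS
    · refine (hnew x y ⟨hx, hy, hd1, hd2, hp⟩).le_mono ?_
      have := mul_nonneg ε0.le (dist_nonneg : 0 ≤ dist x y)
      linarith
  · intro e' lo' he' hlo'
    refine ⟨N', iN', Adj', ω', π' ∘ π, k1, k2, ?_, ?_, le_rfl, ?_⟩
    · intro u
      exact ⟨(k3 u).1, by linarith [(k3 u).2]⟩
    · rcases k4 with h | h
      · exact Or.inl fun u => hlo'.trans (h u)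
      · exact Or.inr h
    · intro x hx y hy c hc
      obtain ⟨c1, hc1, hw⟩ := k5 (π x) (π y) c hc
      have := ext_sound hSS hr (fun u => (hω u).1) hs (S' := S ∪ E) (act := act) (by
        rintro a b l ⟨x, y, h1, h2, h3, h4⟩
        exact ⟨x, h1.1, y, h1.2.1, _, by positivity, h2, h3, h4, hnew x y h1⟩) hw x hx y hy _
        (Wk.nil _) rfl
      exact this.le_mono (by linarith)

end levelStep


section finalPart
variable {X : Type u} [MetricSpace X]

theorem iterate_levels {T : Finset X} {ε W L0 Λ : ℝ} (hT : T.Nonempty) (ε0 : 0 < ε) (ε1 : ε < 1)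
    (hW : 0 < W) (hO : Orc T ε W) (hL0 : 0 < L0) (hΛ0 : 0 < Λ) (hΛ1 : 30000 ≤ ε * Λ)
    (hΛ2 : ε * Λ ≤ 60000)
    {E : Finset (Sym2 X)} (hE : IsEdgeSetOn T E) (hc : ∀ x ∈ T, ∀ y ∈ T, pathDist E x y < ⊤)
    (hM : 0 < edgeWeight E) (m : ℕ) :
    ∃ (S : Finset (Sym2 X)) (Φ r : ℝ), IsEdgeSetOn T S ∧
      edgeWeight S + 12000000000 * W / ε ^ 2 * Φ ≤
        edgeWeight E + 12000000000 * W / ε ^ 2 * (2 * edgeWeight E) ∧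
      0 ≤ r ∧ r ≤ ε * (L0 * Λ ^ m) / 100 ∧
      St T S (ε * (L0 * Λ ^ m) / 100) r (ε * (L0 * Λ ^ m) / 100 / 600) Φ ∧
      ∀ i < m, ∀ x ∈ T, ∀ y ∈ T, L0 * Λ ^ i / 2 < dist x y → dist x y ≤ L0 * Λ ^ i →
        PD S x y ((1 + 3 * ε) * dist x y) := by
  induction m with
  | zero =>
    have hpos : 0 < ε * (L0 * Λ ^ 0) / 100 := by positivity
    refine ⟨E, 2 * edgeWeight E, 0, hE, le_rfl, le_rfl, hpos.le, ?_, fun i hi => by omega⟩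
    obtain ⟨N, iN, Adj, ω, π, h1, h2, h3, h4, h5, h6⟩ := init_state hE hc hT hM _ hpos
    refine ⟨N, iN, Adj, ω, π, h1, h2, h3, ?_, h5, h6⟩
    rcases h4 with h | h
    · exact Or.inl fun u => le_trans (by linarith) (h u)
    · exact Or.inr h
  | succ m ih =>
    obtain ⟨S, Φ, r, hS, hw, hr0, hr1, hst, hall⟩ := ih
    have hL : 0 < L0 * Λ ^ m := by positivity
    obtain ⟨S', Φ', hSS, hS', hw', hnew, hst'⟩ := level_step hT ε0 ε1 hW hO hL hr0 hr1 hS hst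
    have hE1 : ε * (L0 * Λ ^ (m + 1)) = (ε * Λ) * (L0 * Λ ^ m) := by
      rw [pow_succ]
      ring
    have b1 := mul_le_mul_of_nonneg_right hΛ1 hL.le
    have b2 := mul_le_mul_of_nonneg_right hΛ2 hL.le
    have b3 := mul_le_mul_of_nonneg_right ε1.le hL.le
    rw [← hE1] at b1 b2
    refine ⟨S', Φ', r + 4 * (L0 * Λ ^ m), hS', hw'.trans hw, by linarith, by linarith,
      hst' _ _ (by linarith) (by linarith), ?_⟩
    intro i hi x hx y hy h1 h2
    rcases Nat.lt_succ_iff_lt_or_eq.1 hi with h | h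
    · exact (hall i h x hx y hy h1 h2).sub hSS
    · subst h
      exact hnew x hx y hy h1 h2

theorem one_class {T : Finset X} {ε W L0 Λ : ℝ} (hT : T.Nonempty) (ε0 : 0 < ε) (ε1 : ε < 1)
    (hW : 0 < W) (hO : Orc T ε W) (hL0 : 0 < L0) (hΛ0 : 0 < Λ) (hΛ1 : 30000 ≤ ε * Λ)
    (hΛ2 : ε * Λ ≤ 60000)
    {E : Finset (Sym2 X)} (hE : IsEdgeSetOn T E) (hc : ∀ x ∈ T, ∀ y ∈ T, pathDist E x y < ⊤)
    (hM : 0 < edgeWeight E) (m : ℕ) :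
    ∃ S : Finset (Sym2 X), IsEdgeSetOn T S ∧
      edgeWeight S ≤ edgeWeight E + 12000000000 * W / ε ^ 2 * (2 * edgeWeight E) ∧
      ∀ i < m, ∀ x ∈ T, ∀ y ∈ T, L0 * Λ ^ i / 2 < dist x y → dist x y ≤ L0 * Λ ^ i →
        PD S x y ((1 + 3 * ε) * dist x y) := by
  obtain ⟨S, Φ, r, hS, hw, -, -, hst, hall⟩ :=
    iterate_levels hT ε0 ε1 hW hO hL0 hΛ0 hΛ1 hΛ2 hE hc hM m
  refine ⟨S, hS, ?_, hall⟩
  obtain ⟨N, iN, Adj, ω, π, h1, h2, h3, h4, h5, h6⟩ := hst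
  have hΦ : 0 ≤ Φ := le_trans (Finset.sum_nonneg fun u _ => (h3 u).1) h5
  have : 0 ≤ 12000000000 * W / ε ^ 2 * Φ := by positivity
  linarith

theorem all_classes {T : Finset X} {ε W δ Λ : ℝ} (hT : T.Nonempty) (ε0 : 0 < ε) (ε1 : ε < 1)
    (hW : 0 < W) (hO : Orc T ε W) (hδ : 0 < δ) (hΛ0 : 0 < Λ) (hΛ1 : 30000 ≤ ε * Λ)
    (hΛ2 : ε * Λ ≤ 60000)
    {E : Finset (Sym2 X)} (hE : IsEdgeSetOn T E) (hc : ∀ x ∈ T, ∀ y ∈ T, pathDist E x y < ⊤)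
    (hM : 0 < edgeWeight E) (m k : ℕ) :
    ∃ S : Finset (Sym2 X), IsEdgeSetOn T S ∧
      edgeWeight S ≤ k * (edgeWeight E + 12000000000 * W / ε ^ 2 * (2 * edgeWeight E)) ∧
      ∀ t < k, ∀ i < m, ∀ x ∈ T, ∀ y ∈ T, δ * 2 ^ t * Λ ^ i / 2 < dist x y →
        dist x y ≤ δ * 2 ^ t * Λ ^ i → PD S x y ((1 + 3 * ε) * dist x y) := by
  classical
  induction k with
  | zero =>
    refine ⟨∅, ?_, ?_, fun t ht => by omega⟩
    · intro f hf
      simp at hf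
    · simp [edgeWeight]
  | succ k ih =>
    obtain ⟨S, h1, h2, h3⟩ := ih
    obtain ⟨S', h1', h2', h3'⟩ := one_class (L0 := δ * 2 ^ k) hT ε0 ε1 hW hO (by positivity)
      hΛ0 hΛ1 hΛ2 hE hc hM m
    refine ⟨S ∪ S', ?_, ?_, ?_⟩
    · intro f hf
      rcases Finset.mem_union.1 hf with h | h
      · exact h1 f h
      · exact h1' f h
    · have := edgeWeight_union S S'
      push_cast
      linarith
    · intro t ht i hi x hx y hy a b
      rcases Nat.lt_succ_iff_lt_or_eq.1 ht with h | h
      · exact (h3 t h i hi x hx y hy a b).sub Finset.subset_union_left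
      · subst h
        exact (h3' i hi x hx y hy a b).sub Finset.subset_union_right

theorem exists_scale {ε : ℝ} (ε0 : 0 < ε) (ε1 : ε < 1) :
    ∃ k : ℕ, 0 < k ∧ 30000 ≤ ε * 2 ^ k ∧ ε * 2 ^ k ≤ 60000 ∧
      (k : ℝ) ≤ 34 * Real.log (2 + ε⁻¹) := by
  have hinv : 1 ≤ ε⁻¹ := (one_le_inv₀ ε0).2 ε1.le
  obtain ⟨k, hk1, hk2⟩ := exists_nat_pow_near (x := 60000 * ε⁻¹) (y := 2) (by linarith) (by norm_num)
  have e1 : ε * (60000 * ε⁻¹) = 60000 := by field_simp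
  have a1 := mul_le_mul_of_nonneg_left hk1 ε0.le
  have a2 := mul_lt_mul_of_pos_left hk2 ε0
  rw [e1] at a1 a2
  rw [pow_succ] at a2
  refine ⟨k, ?_, by linarith, a1, ?_⟩
  · rcases Nat.eq_zero_or_pos k with h | h
    · subst h
      norm_num at a2
      linarith
    · exact h
  · have l1 : (2 : ℝ) ^ k ≤ 2 ^ 16 * (2 + ε⁻¹) := by
      refine hk1.trans ?_
      norm_num
      linarith
    have l2 := Real.log_le_log (by positivity) l1
    rw [Real.log_mul (by positivity) (by positivity), Real.log_pow, Real.log_pow] at l2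
    have l3 : Real.log 2 ≤ Real.log (2 + ε⁻¹) := Real.log_le_log (by norm_num) (by linarith)
    have l4 : (1 : ℝ) / 2 ≤ Real.log 2 := by linarith [Real.log_two_gt_d9]
    have hk0 : (0 : ℝ) ≤ k := Nat.cast_nonneg k
    push_cast at l2
    nlinarith

theorem exists_min_max (T : Finset X) : ∃ δ D : ℝ, 0 < δ ∧
    ∀ x ∈ T, ∀ y ∈ T, x ≠ y → δ ≤ dist x y ∧ dist x y ≤ D := by
  classical
  have h1 : ∃ δ : ℝ, 0 < δ ∧ ∀ q ∈ T.offDiag, δ ≤ dist q.1 q.2 := by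
    rcases T.offDiag.eq_empty_or_nonempty with h | h
    · exact ⟨1, one_pos, by simp [h]⟩
    · obtain ⟨q, hq, hm⟩ := Finset.exists_min_image T.offDiag (fun q => dist q.1 q.2) h
      exact ⟨dist q.1 q.2, dist_pos.2 (Finset.mem_offDiag.1 hq).2.2, hm⟩
  obtain ⟨δ, hδ, h1⟩ := h1
  refine ⟨δ, ∑ q ∈ T.offDiag, dist q.1 q.2, hδ, fun x hx y hy hxy => ?_⟩
  have hmem : (x, y) ∈ T.offDiag := Finset.mem_offDiag.2 ⟨hx, hy, hxy⟩
  exact ⟨h1 _ hmem, Finset.single_le_sum (f := fun q : X × X => dist q.1 q.2)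
    (fun q _ => dist_nonneg) hmem⟩

theorem main_aux {T : Finset X} {ε W : ℝ} (hT : 2 ≤ T.card) (ε0 : 0 < ε) (ε1 : ε < 1)
    (hW : 0 < W) (hO : Orc T ε W) :
    ∃ S : Finset (Sym2 X), IsEdgeSetOn T S ∧
      (∀ x ∈ T, ∀ y ∈ T, PD S x y ((1 + 1000000000000 * ε) * dist x y)) ∧
      edgeWeight S ≤ 1000000000000 * max W ε⁻¹ * ε⁻¹ ^ 2 * Real.log (2 + ε⁻¹) * mstw T := by
  obtain ⟨E, hE, hc, hmst⟩ := mst_exists (T := T)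
  obtain ⟨x0, hx0, y0, hy0, hne⟩ := Finset.one_lt_card.1 (by omega : 1 < T.card)
  have hTn : T.Nonempty := ⟨x0, hx0⟩
  have hM : 0 < edgeWeight E := by
    refine lt_of_le_of_ne (edgeWeight_nonneg E) fun h => ?_
    obtain ⟨p, hp, hpd⟩ := tour hE hc hTn
    have a1 := hp x0 hx0
    have a2 := hp y0 hy0
    rw [← h] at a1 a2
    have a3 := (hpd x0 hx0 y0 hy0).dist_le (abs_nonneg _)
    have a4 : p x0 - p y0 = 0 := by linarith
    rw [a4, abs_zero] at a3
    exact absurd (dist_pos.2 hne) (not_lt.2 a3)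
  obtain ⟨k, hk0, hk1, hk2, hk3⟩ := exists_scale ε0 ε1
  obtain ⟨δ, D, hδ, hdist⟩ := exists_min_max T
  have hpow : ∀ d : ℝ, ∃ s : ℕ, d ≤ δ * 2 ^ s := by
    intro d
    obtain ⟨s, hs⟩ := pow_unbounded_of_one_lt (d / δ) (by norm_num : (1 : ℝ) < 2)
    refine ⟨s, ?_⟩
    rw [div_lt_iff₀ hδ] at hs
    linarith
  obtain ⟨sm, hsm⟩ := hpow D
  obtain ⟨S, hS1, hS2, hS3⟩ := all_classes (δ := δ) (Λ := 2 ^ k) hTn ε0 ε1 hW hO hδ (by positivity)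
    hk1 hk2 hE hc hM (sm + 1) k
  refine ⟨S, hS1, ?_, ?_⟩
  · intro x hx y hy
    by_cases hxy : x = y
    · rw [hxy]
      exact PD.refl _ _
    classical
    obtain ⟨hd1, hd2⟩ := hdist x hx y hy hxy
    have hs1 := Nat.find_spec (hpow (dist x y))
    have hs2 : Nat.find (hpow (dist x y)) ≤ sm := Nat.find_min' _ (hd2.trans hsm)
    have hs3 := fun j => Nat.find_min (hpow (dist x y)) (m := j)
    obtain ⟨s, hs⟩ : ∃ s, s = Nat.find (hpow (dist x y)) := ⟨_, rfl⟩
    rw [← hs] at hs1 hs2 hs3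
    have hlow : δ * 2 ^ s / 2 < dist x y := by
      rcases Nat.eq_zero_or_pos s with h | h
      · rw [h]
        linarith
      · have := hs3 (s - 1) (by omega)
        have h2 : (2 : ℝ) ^ s = 2 ^ (s - 1) * 2 := by
          rw [← pow_succ]
          congr 1
          omega
        rw [h2]
        linarith
    have hsplit : δ * 2 ^ s = δ * 2 ^ (s % k) * (2 ^ k) ^ (s / k) := by
      rw [mul_assoc, ← pow_mul, ← pow_add, Nat.mod_add_div]
    rw [hsplit] at hs1 hlow
    refine (hS3 (s % k) (Nat.mod_lt _ hk0) (s / k) ?_ x hx y hy hlow hs1).le_mono ?_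
    · exact Nat.lt_succ_of_le ((Nat.div_le_self s k).trans hs2)
    · refine mul_le_mul_of_nonneg_right ?_ dist_nonneg
      linarith
  · rw [hmst]
    refine hS2.trans ?_
    have hinv : 1 ≤ ε⁻¹ := (one_le_inv₀ ε0).2 ε1.le
    obtain ⟨M, hMd⟩ : ∃ M, M = max W ε⁻¹ := ⟨_, rfl⟩
    obtain ⟨q, hq⟩ : ∃ q, q = ε⁻¹ ^ 2 := ⟨_, rfl⟩
    have hM1 : W ≤ M := hMd ▸ le_max_left _ _
    have hM2 : 1 ≤ M := hinv.trans (hMd ▸ le_max_right _ _)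
    have hq1 : 1 ≤ q := by
      rw [hq]
      exact one_le_pow₀ hinv
    have hdiv : 12000000000 * W / ε ^ 2 = 12000000000 * (W * q) := by
      rw [hq, inv_pow, div_eq_mul_inv]
      ring
    rw [hdiv, ← hMd, ← hq]
    have hMq : 1 ≤ M * q := by nlinarith
    have hWq : W * q ≤ M * q := by nlinarith
    have hQ : 0 ≤ Real.log (2 + ε⁻¹) := Real.log_nonneg (by linarith)
    have hk : (0 : ℝ) ≤ k := Nat.cast_nonneg k
    obtain ⟨w, hw⟩ : ∃ w, w = edgeWeight E := ⟨_, rfl⟩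
    rw [← hw] at hM ⊢
    have f1 : w + 12000000000 * (W * q) * (2 * w) ≤ (24000000001 * (M * q)) * w := by
      have : (1 + 24000000000 * (W * q)) * w ≤ (24000000001 * (M * q)) * w :=
        mul_le_mul_of_nonneg_right (by linarith) hM.le
      linarith
    have f0 : 0 ≤ (24000000001 * (M * q)) * w := by positivity
    have hR : 0 ≤ M * q * w * Real.log (2 + ε⁻¹) := by positivity
    calc (k : ℝ) * (w + 12000000000 * (W * q) * (2 * w))
        ≤ k * ((24000000001 * (M * q)) * w) := mul_le_mul_of_nonneg_left f1 hk
      _ ≤ (34 * Real.log (2 + ε⁻¹)) * ((24000000001 * (M * q)) * w) :=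
          mul_le_mul_of_nonneg_right hk3 f0
      _ ≤ 1000000000000 * M * q * Real.log (2 + ε⁻¹) * w := by linarith

end finalPart

/-- Sparse spanner oracles imply light subset spanners (forward direction of Theorem 4). -/
theorem sparse_oracle_implies_light_subset_spanner :
    ∃ C : ℝ, 0 < C ∧
      ∀ (X : Type u) [MetricSpace X] (ε : ℝ), 0 < ε → ε < 1 →
        ∀ T : Finset X, 2 ≤ T.card →
          ∀ W : ℝ, 0 < W →
            (∀ T' : Finset X, T' ⊆ T → T'.Nonempty → ∀ ℓ : ℝ, 0 < ℓ →
              ∃ E : Finset (Sym2 X), IsEdgeSetOn T' E ∧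
                edgeWeight E ≤ W * T'.card * ℓ ∧
                ∀ x ∈ T', ∀ y ∈ T', x ≠ y → ℓ / 8 ≤ dist x y → dist x y ≤ ℓ →
                  pathDist E x y ≤ ENNReal.ofReal ((1 + ε) * dist x y)) →
            ∃ S : Finset (Sym2 X), IsEdgeSetOn T S ∧
              (∀ x ∈ T, ∀ y ∈ T,
                pathDist S x y ≤ ENNReal.ofReal ((1 + C * ε) * dist x y)) ∧
              edgeWeight S ≤ C * max W ε⁻¹ * ε⁻¹ ^ 2 * Real.log (2 + ε⁻¹) * mstw T := by
  refine ⟨1000000000000, by norm_num, ?_⟩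
  intro X _ ε ε0 ε1 T hT W hW hO
  exact main_aux hT ε0 ε1 hW hO
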